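/- Let p ∈ (1,∞). Assume conditions (1.2) and (1.3), let u, v be a principal fundamental system of solutions of (r z')' = q z, and assume that the Green operator G is a bounded operator on L_p(ℝ). Then G : L_p(ℝ) → L_p(ℝ) is a compact operator if and only if h(x) d(x) → 0 as |x| → ∞. -/

import Mathlib

open MeasureTheory Filter Topology
open scoped ENNReal RealInnerProductSpace

noncomputable section

/-- Conditions (1.2): `r, q` measurable, `r > 0`, `q ≥ 0`, with `1/r` and `q`
locally Lebesgue integrable on `ℝ`. -/
def Cond12 (r q : ℝ → ℝ) : Prop :=
  Measurable r ∧ Measurable q ∧ (∀ x, 0 < r x) ∧ (∀ x, 0 ≤ q x) ∧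
    LocallyIntegrable (fun t => 1 / r t) volume ∧ LocallyIntegrable q volume

/-- Condition (1.3): for every `x`,
`(∫_{x-d}^x dt/r(t)) · (∫_{x-d}^x q(t) dt) → ∞` as `|d| → ∞`. -/
def Cond13 (r q : ℝ → ℝ) : Prop :=
  ∀ x : ℝ, Tendsto (fun d : ℝ => (∫ t in x - d..x, 1 / r t) * (∫ t in x - d..x, q t))
    (cocompact ℝ) atTop

/-- Condition (2.1): `∫_{-∞}^x q > 0` and `∫_x^∞ q > 0` for every `x`. -/
def Cond21 (q : ℝ → ℝ) : Prop :=
  ∀ x : ℝ, 0 < ∫⁻ t in Set.Iic x, ENNReal.ofReal (q t) ∧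
    0 < ∫⁻ t in Set.Ici x, ENNReal.ofReal (q t)

/-- A principal fundamental system of solutions `u, v` (with a.e. derivatives
`u', v'`) of the equation `(r z')' = q z`:  `u, v, r u', r v'` are locally
absolutely continuous (expressed through the integral identities below),
`(r u')' = q u` and `(r v')' = q v` a.e., `u > 0`, `v > 0`, `v' ≥ 0`, `u' ≤ 0`,
`r (v' u - u' v) ≡ 1`, `v/u → 0` at `-∞`, `u/v → 0` at `+∞`,
`∫_{-∞}^0 dt/(r u²) < ∞` and `∫_0^∞ dt/(r v²) < ∞`. -/
structure PFSS (r q u v u' v' : ℝ → ℝ) : Prop where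
  u_pos : ∀ x, 0 < u x
  v_pos : ∀ x, 0 < v x
  u'_nonpos : ∀ x, u' x ≤ 0
  v'_nonneg : ∀ x, 0 ≤ v' x
  u'_intble : ∀ a b : ℝ, IntervalIntegrable u' volume a b
  v'_intble : ∀ a b : ℝ, IntervalIntegrable v' volume a b
  u_deriv : ∀ a b : ℝ, u b - u a = ∫ t in a..b, u' t
  v_deriv : ∀ a b : ℝ, v b - v a = ∫ t in a..b, v' t
  ru'_deriv : ∀ a b : ℝ, r b * u' b - r a * u' a = ∫ t in a..b, q t * u t
  rv'_deriv : ∀ a b : ℝ, r b * v' b - r a * v' a = ∫ t in a..b, q t * v t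
  wronskian : ∀ x, r x * (v' x * u x - u' x * v x) = 1
  ratio_bot : Tendsto (fun x => v x / u x) atBot (𝓝 0)
  ratio_top : Tendsto (fun x => u x / v x) atTop (𝓝 0)
  int_u : ∫⁻ t in Set.Iic (0:ℝ), ENNReal.ofReal (1 / (r t * u t ^ 2)) < ⊤
  int_v : ∫⁻ t in Set.Ici (0:ℝ), ENNReal.ofReal (1 / (r t * v t ^ 2)) < ⊤

/-- The Green kernel `G(x,t) = u(x) v(t)` for `x ≥ t`, `u(t) v(x)` for `x ≤ t`. -/
def greenKernel (u v : ℝ → ℝ) (x t : ℝ) : ℝ :=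
  if t ≤ x then u x * v t else u t * v x

/-- The space `L_p(ℝ)` (with respect to Lebesgue measure). -/
abbrev LpR (p : ℝ≥0∞) : Type := Lp ℝ p (volume : Measure ℝ)

/-- `G` is (a bounded realization on `L_p` of) the Green operator
`(G f)(x) = ∫_ℝ G(x,t) f(t) dt`. -/
def IsGreenOp (u v : ℝ → ℝ) (p : ℝ≥0∞) [Fact (1 ≤ p)]
    (G : LpR p →L[ℝ] LpR p) : Prop :=
  ∀ f : LpR p,
    (G f : ℝ → ℝ) =ᵐ[volume] fun x => ∫ t, greenKernel u v x t * (f : ℝ → ℝ) t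

/-- `d₁` solves `(∫_{x-d}^x dt/r)(∫_{x-d}^x q dt) = 1`, `d₁ > 0`. -/
def IsD1 (r q d₁ : ℝ → ℝ) : Prop :=
  ∀ x : ℝ, 0 < d₁ x ∧
    (∫ t in x - d₁ x..x, 1 / r t) * (∫ t in x - d₁ x..x, q t) = 1

/-- `d₂` solves `(∫_x^{x+d} dt/r)(∫_x^{x+d} q dt) = 1`, `d₂ > 0`. -/
def IsD2 (r q d₂ : ℝ → ℝ) : Prop :=
  ∀ x : ℝ, 0 < d₂ x ∧
    (∫ t in x..x + d₂ x, 1 / r t) * (∫ t in x..x + d₂ x, q t) = 1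

/-- `φ(x) = ∫_{x-d₁(x)}^x dt/r(t)`. -/
def phiF (r d₁ : ℝ → ℝ) (x : ℝ) : ℝ := ∫ t in x - d₁ x..x, 1 / r t

/-- `ψ(x) = ∫_x^{x+d₂(x)} dt/r(t)`. -/
def psiF (r d₂ : ℝ → ℝ) (x : ℝ) : ℝ := ∫ t in x..x + d₂ x, 1 / r t

/-- `h(x) = φ(x)ψ(x)/(φ(x)+ψ(x))`. -/
def hF (r d₁ d₂ : ℝ → ℝ) (x : ℝ) : ℝ :=
  phiF r d₁ x * psiF r d₂ x / (phiF r d₁ x + psiF r d₂ x)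

/-- `d` solves `∫_{x-d(x)}^{x+d(x)} dt/(r(t)h(t)) = 1`, `d > 0`. -/
def IsD (r h d : ℝ → ℝ) : Prop :=
  ∀ x : ℝ, 0 < d x ∧ (∫ t in x - d x..x + d x, 1 / (r t * h t)) = 1

/-- `s` solves `∫_{x-s(x)}^{x+s(x)} dt/(r(t)ρ(t)) = 1`, `s > 0`. -/
def IsS (r ρ s : ℝ → ℝ) : Prop :=
  ∀ x : ℝ, 0 < s x ∧ (∫ t in x - s x..x + s x, 1 / (r t * ρ t)) = 1

/-- The logarithm of a positive absolutely continuous function is absolutely continuous. -/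
theorem absolutelyContinuousOnInterval_log_comp {f : ℝ → ℝ} {a b : ℝ}
    (hf : AbsolutelyContinuousOnInterval f a b) (hpos : ∀ x, 0 < f x) :
    AbsolutelyContinuousOnInterval (fun x => Real.log (f x)) a b := by
  obtain ⟨z, -, hz⟩ := isCompact_uIcc.exists_isMinOn Set.nonempty_uIcc hf.continuousOn
  have key : ∀ x ∈ Set.uIcc a b, ∀ y ∈ Set.uIcc a b,
      dist (Real.log (f x)) (Real.log (f y)) ≤ (f z)⁻¹ * dist (f x) (f y) := by
    have h1 : ∀ x ∈ Set.uIcc a b, ∀ y ∈ Set.uIcc a b,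
        Real.log (f x) - Real.log (f y) ≤ (f z)⁻¹ * |f x - f y| := by
      intro x _ y hy
      have hzy : f z ≤ f y := hz hy
      rw [← Real.log_div (hpos x).ne' (hpos y).ne']
      calc Real.log (f x / f y) ≤ f x / f y - 1 := Real.log_le_sub_one_of_pos
            (div_pos (hpos x) (hpos y))
        _ = (f y)⁻¹ * (f x - f y) := by have := (hpos y).ne'; field_simp
        _ ≤ (f y)⁻¹ * |f x - f y| :=
            mul_le_mul_of_nonneg_left (le_abs_self _) (inv_nonneg.2 (hpos y).le)
        _ ≤ (f z)⁻¹ * |f x - f y| :=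
            mul_le_mul_of_nonneg_right (inv_anti₀ (hpos z) hzy) (abs_nonneg _)
    intro x hx y hy
    rw [Real.dist_eq, Real.dist_eq, abs_le]
    have h2 := h1 y hy x hx
    rw [abs_sub_comm] at h2
    exact ⟨by linarith, h1 x hx y hy⟩
  rw [absolutelyContinuousOnInterval_iff] at hf ⊢
  intro ε hε
  obtain ⟨δ, hδ, H⟩ := hf (ε * f z) (mul_pos hε (hpos z))
  refine ⟨δ, hδ, fun E hE hlt => ?_⟩
  have hE' := H E hE hlt
  calc _ ≤ ∑ i ∈ Finset.range E.1, (f z)⁻¹ * dist (f (E.2 i).1) (f (E.2 i).2) :=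
        Finset.sum_le_sum fun i hi => key _ (hE.1 i hi).1 _ (hE.1 i hi).2
    _ < ε := by
        rw [← Finset.mul_sum, inv_mul_lt_iff₀ (hpos z), mul_comm]
        exact hE'

theorem continuous_of_sub_eq_integral {f f' : ℝ → ℝ}
    (hi : ∀ a b : ℝ, IntervalIntegrable f' volume a b)
    (hd : ∀ a b : ℝ, f b - f a = ∫ t in a..b, f' t) : Continuous f := by
  have h : f = fun x => f 0 + ∫ t in (0 : ℝ)..x, f' t := by
    ext x; rw [← hd 0 x]; ring
  rw [h]
  exact continuous_const.add (intervalIntegral.continuous_primitive hi 0)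

theorem log_sub_log_eq_integral {f f' : ℝ → ℝ} (hi : ∀ a b : ℝ, IntervalIntegrable f' volume a b)
    (hd : ∀ a b : ℝ, f b - f a = ∫ t in a..b, f' t)
    (hpos : ∀ x, 0 < f x) (a b : ℝ) :
    IntervalIntegrable (fun t => f' t / f t) volume a b ∧
      Real.log (f b) - Real.log (f a) = ∫ t in a..b, f' t / f t := by
  have hc := continuous_of_sub_eq_integral hi hd
  refine ⟨(hi a b).mul_continuousOn (hc.inv₀ fun x => (hpos x).ne').continuousOn, ?_⟩
  have h : f = fun x => f a + ∫ t in a..x, f' t := by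
    ext x; rw [← hd a x]; ring
  have hac : AbsolutelyContinuousOnInterval f a b := by
    have h1 := (hi a b).absolutelyContinuousOnInterval_intervalIntegral
      (c := a) Set.left_mem_uIcc
    rw [absolutelyContinuousOnInterval_iff] at h1 ⊢
    rw [h]
    simpa using h1
  rw [← (absolutelyContinuousOnInterval_log_comp hac hpos).integral_deriv_eq_sub]
  refine intervalIntegral.integral_congr_ae ?_
  filter_upwards [(hi a b).ae_hasDerivAt_integral] with x hx hxI
  have h2 : HasDerivAt f (f' x) x := by
    rw [h]
    exact (hx (Set.uIoc_subset_uIcc hxI) a Set.left_mem_uIcc).const_add _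
  exact (h2.log (hpos x).ne').deriv

namespace PFSS

variable {r q u v u' v' : ℝ → ℝ}

theorem continuous_u (h : PFSS r q u v u' v') : Continuous u :=
  continuous_of_sub_eq_integral h.u'_intble h.u_deriv

theorem continuous_v (h : PFSS r q u v u' v') : Continuous v :=
  continuous_of_sub_eq_integral h.v'_intble h.v_deriv

theorem antitone_u (h : PFSS r q u v u' v') : Antitone u := by
  intro a b hab
  have h1 := h.u_deriv a b
  have h2 : 0 ≤ ∫ t in a..b, -u' t :=
    intervalIntegral.integral_nonneg hab fun t _ => by linarith [h.u'_nonpos t]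
  rw [intervalIntegral.integral_neg] at h2
  linarith

theorem monotone_v (h : PFSS r q u v u' v') : Monotone v := by
  intro a b hab
  have h1 := h.v_deriv a b
  have h2 : 0 ≤ ∫ t in a..b, v' t :=
    intervalIntegral.integral_nonneg hab fun t _ => h.v'_nonneg t
  linarith

end PFSS

theorem Cond12.intervalIntegrable_inv {r q : ℝ → ℝ} (h : Cond12 r q) (a b : ℝ) :
    IntervalIntegrable (fun t => 1 / r t) volume a b :=
  (h.2.2.2.2.1.integrableOn_isCompact isCompact_uIcc).intervalIntegrable

theorem Cond12.intervalIntegrable_q {r q : ℝ → ℝ} (h : Cond12 r q) (a b : ℝ) :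
    IntervalIntegrable q volume a b :=
  (h.2.2.2.2.2.integrableOn_isCompact isCompact_uIcc).intervalIntegrable

namespace PFSS

variable {r q u v u' v' : ℝ → ℝ}

theorem integral_inv_mul_flux_v (h : PFSS r q u v u' v') (h12 : Cond12 r q) {α β : ℝ}
    (hab : α ≤ β) (h1 : (∫ t in α..β, 1 / r t) * (∫ t in α..β, q t) = 1) :
    v β / 2 ≤ (∫ t in α..β, 1 / r t) * (r β * v' β) ∧
      (∫ t in α..β, 1 / r t) * (r β * v' β) ≤ 2 * v β := by
  have hr := h12.2.2.1
  have hq := h12.2.2.2.1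
  have hqi : ∀ a b, IntervalIntegrable q volume a b := h12.intervalIntegrable_q
  have hqv : ∀ a b, IntervalIntegrable (fun t => q t * v t) volume a b := fun a b =>
    (hqi a b).mul_continuousOn h.continuous_v.continuousOn
  set Φ := ∫ t in α..β, 1 / r t
  set Q := ∫ t in α..β, q t with hQ
  set W := r β * v' β
  have hup : ∀ t ∈ Set.Icc α β, r t * v' t ≤ W := fun t ht => by
    have h2 := h.rv'_deriv t β
    have h3 : 0 ≤ ∫ s in t..β, q s * v s := intervalIntegral.integral_nonneg ht.2
      fun s _ => mul_nonneg (hq s) (h.v_pos s).le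
    linarith
  have hlow : ∀ t ∈ Set.Icc α β, W - Q * v β ≤ r t * v' t := fun t ht => by
    have h2 := h.rv'_deriv t β
    have h3 : ∫ s in t..β, q s * v s ≤ ∫ s in t..β, q s * v β :=
      intervalIntegral.integral_mono_on ht.2 (hqv _ _) ((hqi _ _).mul_const _)
        fun s hs => mul_le_mul_of_nonneg_left (h.monotone_v hs.2) (hq s)
    rw [intervalIntegral.integral_mul_const] at h3
    have h4 : ∫ s in t..β, q s ≤ Q := by
      rw [hQ, ← intervalIntegral.integral_add_adjacent_intervals (hqi α t) (hqi t β)]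
      linarith [intervalIntegral.integral_nonneg ht.1 (μ := volume) fun s _ => hq s]
    nlinarith [h.v_pos β]
  have hv' : ∀ t, v' t = (r t * v' t) * (1 / r t) := fun t => by
    have := (hr t).ne'; field_simp
  have hvu : v β - v α ≤ W * Φ := by
    rw [h.v_deriv, ← intervalIntegral.integral_const_mul]
    refine intervalIntegral.integral_mono_on hab (h.v'_intble _ _)
      ((h12.intervalIntegrable_inv _ _).const_mul _) fun t ht => ?_
    rw [hv' t]
    exact mul_le_mul_of_nonneg_right (hup t ht) (one_div_nonneg.2 (hr t).le)
  have hvl : (W - Q * v β) * Φ ≤ v β - v α := by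
    rw [h.v_deriv, ← intervalIntegral.integral_const_mul]
    refine intervalIntegral.integral_mono_on hab
      ((h12.intervalIntegrable_inv _ _).const_mul _) (h.v'_intble _ _) fun t ht => ?_
    rw [hv' t]
    exact mul_le_mul_of_nonneg_right (hlow t ht) (one_div_nonneg.2 (hr t).le)
  have hWQ : v α * Q ≤ W := by
    have h2 := h.rv'_deriv α β
    have h3 : ∫ s in α..β, q s * v α ≤ ∫ s in α..β, q s * v s :=
      intervalIntegral.integral_mono_on hab ((hqi _ _).mul_const _) (hqv _ _)
        fun s hs => mul_le_mul_of_nonneg_left (h.monotone_v hs.1) (hq s)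
    rw [intervalIntegral.integral_mul_const] at h3
    have h4 : 0 ≤ r α * v' α := mul_nonneg (hr α).le (h.v'_nonneg α)
    linarith
  have hΦ : 0 ≤ Φ := intervalIntegral.integral_nonneg hab
    fun t _ => one_div_nonneg.2 (hr t).le
  have hWQ' : v α ≤ W * Φ := by
    calc v α = v α * Q * Φ := by rw [mul_assoc, mul_comm Q, h1, mul_one]
      _ ≤ W * Φ := mul_le_mul_of_nonneg_right hWQ hΦ
  constructor
  · nlinarith
  · nlinarith [h.v_pos α]

theorem integral_inv_mul_flux_u (h : PFSS r q u v u' v') (h12 : Cond12 r q) {α β : ℝ}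
    (hab : α ≤ β) (h1 : (∫ t in α..β, 1 / r t) * (∫ t in α..β, q t) = 1) :
    u α / 2 ≤ (∫ t in α..β, 1 / r t) * (r α * -u' α) ∧
      (∫ t in α..β, 1 / r t) * (r α * -u' α) ≤ 2 * u α := by
  have hr := h12.2.2.1
  have hq := h12.2.2.2.1
  have hqi : ∀ a b, IntervalIntegrable q volume a b := h12.intervalIntegrable_q
  have hqu : ∀ a b, IntervalIntegrable (fun t => q t * u t) volume a b := fun a b =>
    (hqi a b).mul_continuousOn h.continuous_u.continuousOn
  set Φ := ∫ t in α..β, 1 / r t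
  set Q := ∫ t in α..β, q t with hQ
  set W := r α * -u' α
  have hW : W = r α * -u' α := rfl
  have hup : ∀ t ∈ Set.Icc α β, r t * -u' t ≤ W := fun t ht => by
    have h2 := h.ru'_deriv α t
    have h3 : 0 ≤ ∫ s in α..t, q s * u s := intervalIntegral.integral_nonneg ht.1
      fun s _ => mul_nonneg (hq s) (h.u_pos s).le
    linarith
  have hlow : ∀ t ∈ Set.Icc α β, W - Q * u α ≤ r t * -u' t := fun t ht => by
    have h2 := h.ru'_deriv α t
    have h3 : ∫ s in α..t, q s * u s ≤ ∫ s in α..t, q s * u α :=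
      intervalIntegral.integral_mono_on ht.1 (hqu _ _) ((hqi _ _).mul_const _)
        fun s hs => mul_le_mul_of_nonneg_left (h.antitone_u hs.1) (hq s)
    rw [intervalIntegral.integral_mul_const] at h3
    have h4 : ∫ s in α..t, q s ≤ Q := by
      rw [hQ, ← intervalIntegral.integral_add_adjacent_intervals (hqi α t) (hqi t β)]
      linarith [intervalIntegral.integral_nonneg ht.2 (μ := volume) fun s _ => hq s]
    nlinarith [h.u_pos α]
  have hu' : ∀ t, -u' t = (r t * -u' t) * (1 / r t) := fun t => by
    have := (hr t).ne'; field_simp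
  have hdiff : u α - u β = ∫ t in α..β, -u' t := by
    rw [intervalIntegral.integral_neg, ← h.u_deriv]; ring
  have huu : u α - u β ≤ W * Φ := by
    rw [hdiff, ← intervalIntegral.integral_const_mul]
    refine intervalIntegral.integral_mono_on hab (h.u'_intble _ _).neg
      ((h12.intervalIntegrable_inv _ _).const_mul _) fun t ht => ?_
    rw [hu' t]
    exact mul_le_mul_of_nonneg_right (hup t ht) (one_div_nonneg.2 (hr t).le)
  have hul : (W - Q * u α) * Φ ≤ u α - u β := by
    rw [hdiff, ← intervalIntegral.integral_const_mul]
    refine intervalIntegral.integral_mono_on hab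
      ((h12.intervalIntegrable_inv _ _).const_mul _) (h.u'_intble _ _).neg fun t ht => ?_
    rw [hu' t]
    exact mul_le_mul_of_nonneg_right (hlow t ht) (one_div_nonneg.2 (hr t).le)
  have hWQ : u β * Q ≤ W := by
    have h2 := h.ru'_deriv α β
    have h3 : ∫ s in α..β, q s * u β ≤ ∫ s in α..β, q s * u s :=
      intervalIntegral.integral_mono_on hab ((hqi _ _).mul_const _) (hqu _ _)
        fun s hs => mul_le_mul_of_nonneg_left (h.antitone_u hs.2) (hq s)
    rw [intervalIntegral.integral_mul_const] at h3
    have h4 : 0 ≤ r β * -u' β := mul_nonneg (hr β).le (by linarith [h.u'_nonpos β])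
    linarith
  have hΦ : 0 ≤ Φ := intervalIntegral.integral_nonneg hab
    fun t _ => one_div_nonneg.2 (hr t).le
  have hWQ' : u β ≤ W * Φ := by
    calc u β = u β * Q * Φ := by rw [mul_assoc, mul_comm Q, h1, mul_one]
      _ ≤ W * Φ := mul_le_mul_of_nonneg_right hWQ hΦ
  constructor
  · nlinarith
  · nlinarith [h.u_pos β]

theorem phiF_pos_and_psiF_pos {d₁ d₂ : ℝ → ℝ} (h12 : Cond12 r q) (hd₁ : IsD1 r q d₁)
    (hd₂ : IsD2 r q d₂)
    (x : ℝ) : 0 < phiF r d₁ x ∧ 0 < psiF r d₂ x := by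
  obtain ⟨h1, h2⟩ := hd₁ x
  obtain ⟨h3, h4⟩ := hd₂ x
  have hnn : ∀ a b, a ≤ b → 0 ≤ ∫ t in a..b, 1 / r t := fun a b hab =>
    intervalIntegral.integral_nonneg hab fun t _ => one_div_nonneg.2 (h12.2.2.1 t).le
  refine ⟨lt_of_le_of_ne (hnn _ _ (by linarith)) fun h0 => ?_,
    lt_of_le_of_ne (hnn _ _ (by linarith)) fun h0 => ?_⟩
  · rw [phiF] at h0; rw [← h0] at h2; simp at h2
  · rw [psiF] at h0; rw [← h0] at h4; simp at h4

/-- The Otelbaev-type two-sided estimate `h / 2 ≤ u v ≤ 2 h`. -/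
theorem mul_mem_Icc_hF (h : PFSS r q u v u' v') (h12 : Cond12 r q) {d₁ d₂ : ℝ → ℝ}
    (hd₁ : IsD1 r q d₁) (hd₂ : IsD2 r q d₂) (x : ℝ) :
    0 < hF r d₁ d₂ x ∧ hF r d₁ d₂ x / 2 ≤ u x * v x ∧ u x * v x ≤ 2 * hF r d₁ d₂ x := by
  obtain ⟨hφ, hψ⟩ := phiF_pos_and_psiF_pos h12 hd₁ hd₂ x
  obtain ⟨h1, h2⟩ := h.integral_inv_mul_flux_v h12 (by linarith [(hd₁ x).1]) (hd₁ x).2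
  obtain ⟨h3, h4⟩ := h.integral_inv_mul_flux_u h12 (by linarith [(hd₂ x).1]) (hd₂ x).2
  change _ ≤ phiF r d₁ x * _ at h1
  change phiF r d₁ x * _ ≤ _ at h2
  change _ ≤ psiF r d₂ x * _ at h3
  change psiF r d₂ x * _ ≤ _ at h4
  have hw := h.wronskian x
  rw [hF]
  set φ := phiF r d₁ x
  set ψ := psiF r d₂ x
  set V := r x * v' x
  set U := r x * -u' x
  have hw' : V * u x + U * v x = 1 := by rw [← hw]; ring
  have hu := h.u_pos x
  have hv := h.v_pos x
  have hs : 0 < φ + ψ := by positivity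
  have e : φ * ψ = φ * V * (ψ * u x) + ψ * U * (φ * v x) := by
    linear_combination (-(φ * ψ)) * hw'
  have b1 := mul_le_mul_of_nonneg_right h1 (by positivity : 0 ≤ ψ * u x)
  have b2 := mul_le_mul_of_nonneg_right h2 (by positivity : 0 ≤ ψ * u x)
  have b3 := mul_le_mul_of_nonneg_right h3 (by positivity : 0 ≤ φ * v x)
  have b4 := mul_le_mul_of_nonneg_right h4 (by positivity : 0 ≤ φ * v x)
  refine ⟨by positivity, ?_, ?_⟩
  · rw [div_div, div_le_iff₀ (by positivity)]
    nlinarith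
  · rw [← mul_div_assoc, le_div_iff₀ hs]
    nlinarith

end PFSS

/-- The logarithm of the ratio `v / u`. -/
def logRatio (u v : ℝ → ℝ) (x : ℝ) : ℝ := Real.log (v x) - Real.log (u x)

namespace PFSS

variable {r q u v u' v' : ℝ → ℝ}

theorem logRatio_sub (h : PFSS r q u v u' v') (h12 : Cond12 r q) (a b : ℝ) :
    IntervalIntegrable (fun t => 1 / (r t * (u t * v t))) volume a b ∧
      logRatio u v b - logRatio u v a = ∫ t in a..b, 1 / (r t * (u t * v t)) := by
  obtain ⟨i1, e1⟩ := log_sub_log_eq_integral h.v'_intble h.v_deriv h.v_pos a b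
  obtain ⟨i2, e2⟩ := log_sub_log_eq_integral h.u'_intble h.u_deriv h.u_pos a b
  have e : (fun t => 1 / (r t * (u t * v t))) = fun t => v' t / v t - u' t / u t := by
    ext t
    have := (h12.2.2.1 t).ne'
    have := (h.u_pos t).ne'
    have := (h.v_pos t).ne'
    rw [← h.wronskian t]
    field_simp
  rw [e, intervalIntegral.integral_sub i1 i2, ← e1, ← e2]
  refine ⟨i1.sub i2, ?_⟩
  simp only [logRatio]
  ring

theorem logRatio_sub_mem_Icc (h : PFSS r q u v u' v') (h12 : Cond12 r q) {d₁ d₂ d : ℝ → ℝ}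
    (hd₁ : IsD1 r q d₁) (hd₂ : IsD2 r q d₂) (hd : IsD r (hF r d₁ d₂) d) (x : ℝ) :
    1 / 2 ≤ logRatio u v (x + d x) - logRatio u v (x - d x) ∧
      logRatio u v (x + d x) - logRatio u v (x - d x) ≤ 2 := by
  obtain ⟨hpos, h1⟩ := hd x
  obtain ⟨i, e⟩ := h.logRatio_sub h12 (x - d x) (x + d x)
  have hle : x - d x ≤ x + d x := by linarith
  have ih : IntervalIntegrable (fun t => 1 / (r t * hF r d₁ d₂ t)) volume
      (x - d x) (x + d x) := by
    by_contra hn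
    rw [intervalIntegral.integral_undef hn] at h1
    norm_num at h1
  rw [e]
  constructor
  · rw [show (1 : ℝ) / 2 = ∫ t in x - d x..x + d x, 2⁻¹ * (1 / (r t * hF r d₁ d₂ t)) by
      rw [intervalIntegral.integral_const_mul, h1]; norm_num]
    refine intervalIntegral.integral_mono_on hle (ih.const_mul _) i fun t _ => ?_
    obtain ⟨a1, a2, a3⟩ := h.mul_mem_Icc_hF h12 hd₁ hd₂ t
    have hr := h12.2.2.1 t
    have := mul_pos (h.u_pos t) (h.v_pos t)
    rw [one_div, one_div, ← mul_inv]
    exact inv_anti₀ (by positivity) (by nlinarith)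
  · rw [show (2 : ℝ) = ∫ t in x - d x..x + d x, 2 * (1 / (r t * hF r d₁ d₂ t)) by
      rw [intervalIntegral.integral_const_mul, h1, mul_one]]
    refine intervalIntegral.integral_mono_on hle i (ih.const_mul _) fun t _ => ?_
    obtain ⟨a1, a2, a3⟩ := h.mul_mem_Icc_hF h12 hd₁ hd₂ t
    have hr := h12.2.2.1 t
    rw [show (2 : ℝ) * (1 / (r t * hF r d₁ d₂ t)) = 1 / (r t * (hF r d₁ d₂ t / 2)) by
      field_simp]
    exact one_div_le_one_div_of_le (by positivity) (by nlinarith)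

theorem tendsto_logRatio_atTop (h : PFSS r q u v u' v') :
    Tendsto (logRatio u v) atTop atTop := by
  have h1 : Tendsto (fun x => u x / v x) atTop (𝓝[>] 0) :=
    tendsto_nhdsWithin_iff.2 ⟨h.ratio_top,
      Eventually.of_forall fun x => div_pos (h.u_pos x) (h.v_pos x)⟩
  refine (tendsto_neg_atBot_atTop.comp (Real.tendsto_log_nhdsGT_zero.comp h1)).congr
    fun x => ?_
  simp only [Function.comp_apply, logRatio]
  rw [Real.log_div (h.u_pos x).ne' (h.v_pos x).ne']
  ring

theorem tendsto_logRatio_atBot (h : PFSS r q u v u' v') :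
    Tendsto (logRatio u v) atBot atBot := by
  have h1 : Tendsto (fun x => v x / u x) atBot (𝓝[>] 0) :=
    tendsto_nhdsWithin_iff.2 ⟨h.ratio_bot,
      Eventually.of_forall fun x => div_pos (h.v_pos x) (h.u_pos x)⟩
  refine (Real.tendsto_log_nhdsGT_zero.comp h1).congr fun x => ?_
  simp only [Function.comp_apply, logRatio]
  rw [Real.log_div (h.v_pos x).ne' (h.u_pos x).ne']

end PFSS

/-- A decreasing and an increasing positive continuous function. -/
structure MonotonePair (u v : ℝ → ℝ) : Prop where
  continuous_u : Continuous u
  continuous_v : Continuous v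
  u_pos : ∀ x, 0 < u x
  v_pos : ∀ x, 0 < v x
  antitone_u : Antitone u
  monotone_v : Monotone v

theorem PFSS.monotonePair {r q u v u' v' : ℝ → ℝ} (h : PFSS r q u v u' v') :
    MonotonePair u v :=
  ⟨h.continuous_u, h.continuous_v, h.u_pos, h.v_pos, h.antitone_u, h.monotone_v⟩

theorem greenKernel_comm (u v : ℝ → ℝ) (x t : ℝ) : greenKernel u v x t = greenKernel u v t x := by
  unfold greenKernel
  rcases lt_trichotomy x t with h | rfl | h
  · rw [if_neg (not_le.2 h), if_pos h.le]
  · rfl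
  · rw [if_pos h.le, if_neg (not_le.2 h)]

namespace MonotonePair

variable {u v : ℝ → ℝ}

theorem continuous_logRatio (h : MonotonePair u v) : Continuous (logRatio u v) :=
  (h.continuous_v.log fun x => (h.v_pos x).ne').sub (h.continuous_u.log fun x => (h.u_pos x).ne')

theorem log_u_le (h : MonotonePair u v) {s t : ℝ} (hst : s ≤ t) :
    Real.log (u t) ≤ Real.log (u s) :=
  Real.log_le_log (h.u_pos t) (h.antitone_u hst)

theorem log_v_le (h : MonotonePair u v) {s t : ℝ} (hst : s ≤ t) :
    Real.log (v s) ≤ Real.log (v t) :=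
  Real.log_le_log (h.v_pos s) (h.monotone_v hst)

theorem monotone_logRatio (h : MonotonePair u v) : Monotone (logRatio u v) := fun s t hst => by
  have := h.log_u_le hst
  have := h.log_v_le hst
  simp only [logRatio]
  linarith

theorem mul_pos (h : MonotonePair u v) (x : ℝ) : 0 < u x * v x :=
  _root_.mul_pos (h.u_pos x) (h.v_pos x)

theorem measurable_greenKernel (h : MonotonePair u v) :
    Measurable fun z : ℝ × ℝ => greenKernel u v z.1 z.2 := by
  have hu := h.continuous_u.measurable
  have hv := h.continuous_v.measurable
  exact Measurable.ite (measurableSet_le measurable_snd measurable_fst)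
    ((hu.comp measurable_fst).mul (hv.comp measurable_snd))
    ((hu.comp measurable_snd).mul (hv.comp measurable_fst))

theorem greenKernel_pos (h : MonotonePair u v) (x t : ℝ) : 0 < greenKernel u v x t := by
  unfold greenKernel
  split_ifs
  · exact _root_.mul_pos (h.u_pos _) (h.v_pos _)
  · exact _root_.mul_pos (h.u_pos _) (h.v_pos _)

theorem mul_le_exp_mul (h : MonotonePair u v) (s t : ℝ) :
    u s * v s ≤ Real.exp |logRatio u v s - logRatio u v t| * (u t * v t) := by
  rw [← Real.exp_log (h.u_pos s), ← Real.exp_log (h.v_pos s), ← Real.exp_log (h.u_pos t),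
    ← Real.exp_log (h.v_pos t), ← Real.exp_add, ← Real.exp_add, ← Real.exp_add, Real.exp_le_exp]
  simp only [logRatio]
  rcases le_total s t with hst | hst
  · have := h.log_u_le hst
    have := h.log_v_le hst
    rw [abs_of_nonpos] <;> linarith
  · have := h.log_u_le hst
    have := h.log_v_le hst
    rw [abs_of_nonneg] <;> linarith

theorem exp_mul_le_greenKernel (h : MonotonePair u v) (x t : ℝ) :
    Real.exp (-|logRatio u v x - logRatio u v t|) * (u x * v x) ≤ greenKernel u v x t := by
  have e : u x * v x = Real.exp (Real.log (u x) + Real.log (v x)) := by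
    rw [Real.exp_add, Real.exp_log (h.u_pos x), Real.exp_log (h.v_pos x)]
  rw [e, ← Real.exp_add]
  unfold greenKernel
  simp only [logRatio]
  split_ifs with htx
  · rw [← Real.exp_log (_root_.mul_pos (h.u_pos x) (h.v_pos t)), Real.exp_le_exp,
      Real.log_mul (h.u_pos x).ne' (h.v_pos t).ne']
    have := h.log_u_le htx
    have := h.log_v_le htx
    rw [abs_of_nonneg] <;> linarith
  · rw [← Real.exp_log (_root_.mul_pos (h.u_pos t) (h.v_pos x)), Real.exp_le_exp,
      Real.log_mul (h.u_pos t).ne' (h.v_pos x).ne']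
    have := h.log_u_le (not_le.1 htx).le
    have := h.log_v_le (not_le.1 htx).le
    rw [abs_of_nonpos] <;> linarith

theorem greenKernel_mul_rpow_le (h : MonotonePair u v) {a δ : ℝ} (hδa : δ ≤ a)
    (hδa' : δ ≤ 1 - a) (x t : ℝ) :
    greenKernel u v x t * (u t * v t) ^ a ≤
      (u x * v x) ^ a * Real.exp (-(δ * |logRatio u v x - logRatio u v t|)) * (u t * v t) := by
  have e : ∀ y z, u y * v z = Real.exp (Real.log (u y) + Real.log (v z)) := fun y z => by
    rw [Real.exp_add, Real.exp_log (h.u_pos y), Real.exp_log (h.v_pos z)]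
  unfold greenKernel
  simp only [logRatio]
  simp only [e, ← Real.exp_mul]
  split_ifs with htx
  · rw [← Real.exp_add, ← Real.exp_add, ← Real.exp_add, Real.exp_le_exp]
    have h1 := h.log_u_le htx
    have h2 := h.log_v_le htx
    rw [abs_of_nonneg (by linarith)]
    nlinarith
  · rw [← Real.exp_add, ← Real.exp_add, ← Real.exp_add, Real.exp_le_exp]
    have h1 := h.log_u_le (not_le.1 htx).le
    have h2 := h.log_v_le (not_le.1 htx).le
    rw [abs_of_nonpos (by linarith)]
    nlinarith

theorem setLIntegral_mul_le (h : MonotonePair u v) {d : ℝ → ℝ}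
    (hθ : ∀ x, 1 / 2 ≤ logRatio u v (x + d x) - logRatio u v (x - d x)) {J : Set ℝ}
    (hJ : J.OrdConnected) (hJθ : ∀ s ∈ J, ∀ t ∈ J, logRatio u v s - logRatio u v t < 1 / 2)
    {ε : ℝ} (hε : ∀ m ∈ J, u m * v m * d m ≤ ε) :
    ∫⁻ t in J, ENNReal.ofReal (u t * v t) ≤ ENNReal.ofReal (2 * Real.exp 1 * ε) := by
  rcases J.eq_empty_or_nonempty with rfl | ⟨t₀, ht₀⟩
  · simp
  have hcmp : ∀ s ∈ J, ∀ t ∈ J, u s * v s ≤ Real.exp (1 / 2) * (u t * v t) := by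
    intro s hs t ht
    refine (h.mul_le_exp_mul s t).trans
      (mul_le_mul_of_nonneg_right (Real.exp_le_exp.2 (abs_le.2 ?_)) (h.mul_pos t).le)
    have := hJθ s hs t ht
    have := hJθ t ht s hs
    constructor <;> linarith
  have hρ := h.mul_pos t₀
  have hdist : ∀ s ∈ J, ∀ t ∈ J, s ≤ t →
      t - s ≤ 2 * Real.exp (1 / 2) * ε / (u t₀ * v t₀) := by
    intro s hs t ht hst
    set m := (s + t) / 2 with hm
    have hmJ : m ∈ J := hJ.out hs ht ⟨by linarith, by linarith⟩
    have hdm : (t - s) / 2 < d m := by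
      by_contra! hcon
      have h1 := h.monotone_logRatio (show m + d m ≤ t by linarith)
      have h2 := h.monotone_logRatio (show s ≤ m - d m by linarith)
      have := hθ m
      have := hJθ t ht s hs
      linarith
    rw [le_div_iff₀ hρ]
    have h3 := hcmp t₀ ht₀ m hmJ
    have h4 := hε m hmJ
    calc (t - s) * (u t₀ * v t₀) ≤ (2 * d m) * (Real.exp (1 / 2) * (u m * v m)) := by
          apply mul_le_mul (by linarith) h3 hρ.le; linarith
      _ = 2 * Real.exp (1 / 2) * (u m * v m * d m) := by ring
      _ ≤ 2 * Real.exp (1 / 2) * ε := by gcongr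
  have hvol : volume J ≤ ENNReal.ofReal (2 * Real.exp (1 / 2) * ε / (u t₀ * v t₀)) := by
    refine (Real.volume_le_diam J).trans (Metric.ediam_le fun s hs t ht => ?_)
    rw [edist_dist, Real.dist_eq]
    refine ENNReal.ofReal_le_ofReal (abs_le'.2 ⟨?_, ?_⟩)
    · rcases le_total t s with hst | hst
      · exact hdist t ht s hs hst
      · linarith [hdist s hs t ht hst]
    · rcases le_total t s with hst | hst
      · linarith [hdist t ht s hs hst]
      · linarith [hdist s hs t ht hst]
  calc ∫⁻ t in J, ENNReal.ofReal (u t * v t)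
      ≤ ∫⁻ _ in J, ENNReal.ofReal (Real.exp (1 / 2) * (u t₀ * v t₀)) :=
        setLIntegral_mono' hJ.measurableSet
          fun t ht => ENNReal.ofReal_le_ofReal (hcmp t ht t₀ ht₀)
    _ = ENNReal.ofReal (Real.exp (1 / 2) * (u t₀ * v t₀)) * volume J := setLIntegral_const _ _
    _ ≤ ENNReal.ofReal (Real.exp (1 / 2) * (u t₀ * v t₀)) *
          ENNReal.ofReal (2 * Real.exp (1 / 2) * ε / (u t₀ * v t₀)) := by gcongr
    _ = ENNReal.ofReal (2 * Real.exp 1 * ε) := by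
        rw [← ENNReal.ofReal_mul (by positivity)]
        congr 1
        rw [show Real.exp 1 = Real.exp (1 / 2) * Real.exp (1 / 2) by
          rw [← Real.exp_add]; norm_num]
        have := (h.u_pos t₀).ne'
        have := (h.v_pos t₀).ne'
        field_simp

end MonotonePair

theorem lintegral_exp_neg_mul_abs_sub {δ : ℝ} (hδ : 0 < δ) (c : ℝ) :
    ∫⁻ y : ℝ, ENNReal.ofReal (Real.exp (-(δ * |c - y|))) = ENNReal.ofReal (2 / δ) := by
  have h1 : ∫ y : ℝ, Real.exp (-(δ * |y|)) = 2 / δ := by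
    rw [integral_comp_abs (f := fun y => Real.exp (-(δ * y)))]
    simp_rw [← neg_mul]
    rw [integral_exp_mul_Ioi (by linarith) 0]
    simp only [mul_zero, Real.exp_zero]
    field_simp
  have hint : Integrable (fun y : ℝ => Real.exp (-(δ * |y|))) :=
    Integrable.of_integral_ne_zero (by rw [h1]; positivity)
  rw [← ofReal_integral_eq_lintegral_ofReal (hint.comp_sub_left c)
    (Eventually.of_forall fun y => (Real.exp_pos _).le),
    integral_sub_left_eq_self (fun y => Real.exp (-(δ * |y|))), h1]

namespace MonotonePair

variable {u v : ℝ → ℝ}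

theorem exists_setLIntegral_greenKernel_le (h : MonotonePair u v) {d : ℝ → ℝ}
    (hθ : ∀ x, 1 / 2 ≤ logRatio u v (x + d x) - logRatio u v (x - d x)) {a : ℝ}
    (ha0 : 0 < a) (ha1 : a < 1) :
    ∃ C : ℝ, 0 < C ∧ ∀ (S : Set ℝ) (ε : ℝ), S.OrdConnected → 0 ≤ ε →
      (∀ m ∈ S, u m * v m * d m ≤ ε) → ∀ x,
      ∫⁻ t in S, ENNReal.ofReal (greenKernel u v x t * (u t * v t) ^ a) ≤
        ENNReal.ofReal (C * ε * (u x * v x) ^ a) := by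
  obtain ⟨δ, hδ, hδa, hδa'⟩ : ∃ δ : ℝ, 0 < δ ∧ δ ≤ a ∧ δ ≤ 1 - a :=
    ⟨min a (1 - a), lt_min ha0 (by linarith), min_le_left _ _, min_le_right _ _⟩
  refine ⟨2 * Real.exp (δ / 4) * (2 * Real.exp 1) * (2 / δ), by positivity,
    fun S ε hS hε0 hε x => ?_⟩
  set θ := logRatio u v with hθdef
  have hθc : Continuous θ := h.continuous_logRatio
  set k : ℝ → ℝ := fun t => greenKernel u v x t * (u t * v t) ^ a with hk
  have hkm : Measurable k :=
    (h.measurable_greenKernel.comp measurable_prodMk_left).mul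
      ((h.continuous_u.measurable.mul h.continuous_v.measurable).pow_const a)
  let E : Set (ℝ × ℝ) := {z | |θ z.1 - z.2| < 1 / 4}
  have hE : MeasurableSet E := measurableSet_lt (by fun_prop) measurable_const
  let F : ℝ × ℝ → ℝ≥0∞ := E.indicator fun z => ENNReal.ofReal (k z.1)
  have hF : Measurable F := (by fun_prop : Measurable fun z : ℝ × ℝ =>
    ENNReal.ofReal (k z.1)).indicator hE
  have hslice : ∀ t, 2 * ∫⁻ y, F (t, y) = ENNReal.ofReal (k t) := by
    intro t
    have e1 : (fun y => F (t, y)) =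
        (Metric.ball (θ t) (1 / 4)).indicator fun _ => ENNReal.ofReal (k t) := by
      ext y
      simp only [F, E, Set.indicator, Set.mem_ofPred_eq, Metric.mem_ball, Real.dist_eq,
        abs_sub_comm y]
    rw [e1, lintegral_indicator_const measurableSet_ball, Real.volume_ball, mul_left_comm,
      show (2 : ℝ≥0∞) = ENNReal.ofReal 2 by simp, ← ENNReal.ofReal_mul (by norm_num)]
    norm_num
  have hinner : ∀ y, ∫⁻ t in S, F (t, y) ≤
      ENNReal.ofReal ((u x * v x) ^ a * Real.exp (δ / 4) * (2 * Real.exp 1 * ε)) *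
        ENNReal.ofReal (Real.exp (-(δ * |θ x - y|))) := by
    intro y
    set J : Set ℝ := S ∩ θ ⁻¹' Metric.ball y (1 / 4) with hJdef
    have hJ : J.OrdConnected := by
      refine hS.inter (Set.OrdConnected.preimage_mono ?_ h.monotone_logRatio)
      rw [Real.ball_eq_Ioo]
      exact Set.ordConnected_Ioo
    have hJy : ∀ t ∈ J, |θ t - y| < 1 / 4 := fun t ht => by
      have := ht.2
      rwa [Set.mem_preimage, Metric.mem_ball, Real.dist_eq] at this
    have e1 : ∫⁻ t in S, F (t, y) = ∫⁻ t in J, ENNReal.ofReal (k t) := by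
      have e2 : (fun t => F (t, y)) =
          (θ ⁻¹' Metric.ball y (1 / 4)).indicator fun t => ENNReal.ofReal (k t) := by
        ext t
        simp only [F, E, Set.indicator, Set.mem_ofPred_eq, Set.mem_preimage,
          Metric.mem_ball, Real.dist_eq]
      rw [e2, lintegral_indicator (hθc.measurable measurableSet_ball),
        Measure.restrict_restrict (hθc.measurable measurableSet_ball), Set.inter_comm]
    have hρx : 0 < (u x * v x) ^ a := Real.rpow_pos_of_pos (h.mul_pos x) a
    have hkJ : ∀ t ∈ J, k t ≤
        (u x * v x) ^ a * Real.exp (δ / 4) * Real.exp (-(δ * |θ x - y|)) * (u t * v t) := by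
      intro t ht
      refine (h.greenKernel_mul_rpow_le hδa hδa' x t).trans ?_
      rw [mul_assoc _ (Real.exp (δ / 4)), ← Real.exp_add]
      refine mul_le_mul_of_nonneg_right (mul_le_mul_of_nonneg_left (Real.exp_le_exp.2 ?_) hρx.le)
        (h.mul_pos t).le
      have h1 := abs_sub_le (θ x) (θ t) y
      have h2 := hJy t ht
      rw [← hθdef]
      nlinarith
    have hJθ : ∀ s ∈ J, ∀ t ∈ J, θ s - θ t < 1 / 2 := fun s hs t ht => by
      have h1 := abs_lt.1 (hJy s hs)
      have h2 := abs_lt.1 (hJy t ht)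
      linarith [h1.2, h2.1]
    calc ∫⁻ t in S, F (t, y) = ∫⁻ t in J, ENNReal.ofReal (k t) := e1
      _ ≤ ∫⁻ t in J, ENNReal.ofReal ((u x * v x) ^ a * Real.exp (δ / 4) *
            Real.exp (-(δ * |θ x - y|))) * ENNReal.ofReal (u t * v t) := by
          refine setLIntegral_mono' hJ.measurableSet fun t ht => ?_
          rw [← ENNReal.ofReal_mul (by positivity)]
          exact ENNReal.ofReal_le_ofReal (hkJ t ht)
      _ = ENNReal.ofReal ((u x * v x) ^ a * Real.exp (δ / 4) *
            Real.exp (-(δ * |θ x - y|))) * ∫⁻ t in J, ENNReal.ofReal (u t * v t) :=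
          lintegral_const_mul' _ _ ENNReal.ofReal_ne_top
      _ ≤ ENNReal.ofReal ((u x * v x) ^ a * Real.exp (δ / 4) *
            Real.exp (-(δ * |θ x - y|))) * ENNReal.ofReal (2 * Real.exp 1 * ε) := by
          gcongr
          exact h.setLIntegral_mul_le hθ hJ hJθ fun m hm => hε m hm.1
      _ = _ := by
          rw [← ENNReal.ofReal_mul (by positivity), ← ENNReal.ofReal_mul (by positivity)]
          congr 1
          ring
  calc ∫⁻ t in S, ENNReal.ofReal (k t) = ∫⁻ t in S, 2 * ∫⁻ y, F (t, y) := by simp_rw [hslice]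
    _ = 2 * ∫⁻ t in S, ∫⁻ y, F (t, y) := lintegral_const_mul' _ _ (by norm_num)
    _ = 2 * ∫⁻ y, ∫⁻ t in S, F (t, y) := by
        rw [lintegral_lintegral_swap]
        exact hF.aemeasurable
    _ ≤ 2 * ∫⁻ y, ENNReal.ofReal ((u x * v x) ^ a * Real.exp (δ / 4) * (2 * Real.exp 1 * ε)) *
          ENNReal.ofReal (Real.exp (-(δ * |θ x - y|))) := by
        gcongr with y
        exact hinner y
    _ = ENNReal.ofReal 2 * (ENNReal.ofReal ((u x * v x) ^ a * Real.exp (δ / 4) *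
          (2 * Real.exp 1 * ε)) * ENNReal.ofReal (2 / δ)) := by
        rw [lintegral_const_mul' _ _ ENNReal.ofReal_ne_top, lintegral_exp_neg_mul_abs_sub hδ]
        simp
    _ = _ := by
        have := h.mul_pos x
        rw [← ENNReal.ofReal_mul (by positivity), ← ENNReal.ofReal_mul (by positivity)]
        congr 1
        ring

end MonotonePair

/-- The Schur test with a weight. -/
theorem lintegral_rpow_lintegral_mul_le {P Q : ℝ} (hPQ : P.HolderConjugate Q)
    {K : ℝ → ℝ → ℝ≥0∞} (hK : Measurable (Function.uncurry K)) {w : ℝ → ℝ≥0∞}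
    (hw : Measurable w) (hw0 : ∀ x, w x ≠ 0) (hwt : ∀ x, w x ≠ ⊤) {A : ℝ≥0∞} (hA : A ≠ ⊤)
    (h1 : ∀ x, ∫⁻ t, K x t * w t ^ Q ≤ A * w x ^ Q)
    (h2 : ∀ t, ∫⁻ x, K x t * w x ^ P ≤ A * w t ^ P) {f : ℝ → ℝ≥0∞} (hf : Measurable f) :
    ∫⁻ x, (∫⁻ t, K x t * f t) ^ P ≤ A ^ P * ∫⁻ t, f t ^ P := by
  have hP := hPQ.pos
  have hQ := hPQ.symm.pos
  have hKx : ∀ x, Measurable (K x) := fun x => hK.comp measurable_prodMk_left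
  have hKt : ∀ t, Measurable fun x => K x t := fun t => hK.comp measurable_prodMk_right
  have hpt : ∀ x, (∫⁻ t, K x t * f t) ^ P ≤
      A ^ (P / Q) * ∫⁻ t, w x ^ P * (K x t * (f t ^ P * (w t)⁻¹ ^ P)) := by
    intro x
    have e0 : ∀ t, K x t * f t =
        ((fun t => K x t ^ (1 / P) * (f t * (w t)⁻¹)) * fun t => K x t ^ (1 / Q) * w t) t := by
      intro t
      have e1 : K x t ^ (1 / P) * K x t ^ (1 / Q) = K x t := by
        rw [← ENNReal.rpow_add_of_nonneg _ _ (by positivity) (by positivity), one_div, one_div,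
          hPQ.inv_add_inv_eq_one, ENNReal.rpow_one]
      calc K x t * f t = (K x t ^ (1 / P) * K x t ^ (1 / Q)) * (f t * ((w t)⁻¹ * w t)) := by
            rw [e1, ENNReal.inv_mul_cancel (hw0 t) (hwt t), mul_one]
        _ = _ := by simp only [Pi.mul_apply]; ring
    have e2 : ∀ t, (K x t ^ (1 / P) * (f t * (w t)⁻¹)) ^ P = K x t * (f t ^ P * (w t)⁻¹ ^ P) := by
      intro t
      rw [ENNReal.mul_rpow_of_nonneg _ _ hP.le, ENNReal.mul_rpow_of_nonneg _ _ hP.le,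
        ← ENNReal.rpow_mul, one_div_mul_cancel hP.ne', ENNReal.rpow_one]
    have e3 : ∀ t, (K x t ^ (1 / Q) * w t) ^ Q = K x t * w t ^ Q := by
      intro t
      rw [ENNReal.mul_rpow_of_nonneg _ _ hQ.le, ← ENNReal.rpow_mul, one_div_mul_cancel hQ.ne',
        ENNReal.rpow_one]
    have hH := ENNReal.lintegral_mul_le_Lp_mul_Lq volume hPQ
      (f := fun t => K x t ^ (1 / P) * (f t * (w t)⁻¹)) (g := fun t => K x t ^ (1 / Q) * w t)
      (((hKx x).pow_const _).mul (hf.mul hw.inv)).aemeasurable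
      (((hKx x).pow_const _).mul hw).aemeasurable
    simp_rw [← e0, e2, e3] at hH
    calc (∫⁻ t, K x t * f t) ^ P
        ≤ ((∫⁻ t, K x t * (f t ^ P * (w t)⁻¹ ^ P)) ^ (1 / P) * (A * w x ^ Q) ^ (1 / Q)) ^ P := by
          refine ENNReal.rpow_le_rpow (hH.trans ?_) hP.le
          gcongr
          exact h1 x
      _ = A ^ (P / Q) * (w x ^ P * ∫⁻ t, K x t * (f t ^ P * (w t)⁻¹ ^ P)) := by
          rw [ENNReal.mul_rpow_of_nonneg _ _ hP.le, ← ENNReal.rpow_mul,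
            one_div_mul_cancel hP.ne', ENNReal.rpow_one,
            ENNReal.mul_rpow_of_nonneg _ _ (by positivity),
            ENNReal.mul_rpow_of_nonneg _ _ hP.le, ← ENNReal.rpow_mul, ← ENNReal.rpow_mul,
            ← ENNReal.rpow_mul, show Q * (1 / Q * P) = P by field_simp,
            show 1 / Q * P = P / Q by ring]
          ring
      _ = _ := by
          rw [lintegral_const_mul' _ _ (ENNReal.rpow_ne_top_of_nonneg hP.le (hwt x))]
  calc ∫⁻ x, (∫⁻ t, K x t * f t) ^ P
      ≤ ∫⁻ x, A ^ (P / Q) * ∫⁻ t, w x ^ P * (K x t * (f t ^ P * (w t)⁻¹ ^ P)) :=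
        lintegral_mono hpt
    _ = A ^ (P / Q) * ∫⁻ x, ∫⁻ t, w x ^ P * (K x t * (f t ^ P * (w t)⁻¹ ^ P)) :=
        lintegral_const_mul' _ _ (ENNReal.rpow_ne_top_of_nonneg (by positivity) hA)
    _ = A ^ (P / Q) * ∫⁻ t, ∫⁻ x, w x ^ P * (K x t * (f t ^ P * (w t)⁻¹ ^ P)) := by
        rw [lintegral_lintegral_swap]
        refine Measurable.aemeasurable ?_
        exact ((hw.comp measurable_fst).pow_const P).mul (hK.mul
          (((hf.comp measurable_snd).pow_const P).mul ((hw.comp measurable_snd).inv.pow_const P)))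
    _ ≤ A ^ (P / Q) * ∫⁻ t, A * f t ^ P := by
        gcongr with t
        calc ∫⁻ x, w x ^ P * (K x t * (f t ^ P * (w t)⁻¹ ^ P))
            = ∫⁻ x, K x t * w x ^ P * (f t ^ P * (w t)⁻¹ ^ P) := by
              congr 1 with x; ring
          _ = (∫⁻ x, K x t * w x ^ P) * (f t ^ P * (w t)⁻¹ ^ P) :=
              lintegral_mul_const _ ((hKt t).mul (hw.pow_const P))
          _ ≤ A * w t ^ P * (f t ^ P * (w t)⁻¹ ^ P) := by gcongr; exact h2 t
          _ = A * f t ^ P * (w t ^ P * (w t)⁻¹ ^ P) := by ring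
          _ = A * f t ^ P := by
              rw [← ENNReal.mul_rpow_of_nonneg _ _ hP.le,
                ENNReal.mul_inv_cancel (hw0 t) (hwt t), ENNReal.one_rpow, mul_one]
    _ = A ^ P * ∫⁻ t, f t ^ P := by
        rw [lintegral_const_mul' _ _ hA, ← mul_assoc]
        congr 1
        nth_rewrite 2 [← ENNReal.rpow_one A]
        rw [← ENNReal.rpow_add_of_nonneg _ _ (by positivity) zero_le_one]
        congr 1
        have := hPQ.inv_add_inv_eq_one
        field_simp at this ⊢
        linarith

section Operators

variable {p : ℝ≥0∞}

/-- The class in `L_p` of the restriction of `f` to `S`, extended by zero. -/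
def indicatorLp {S : Set ℝ} (hS : MeasurableSet S) (f : LpR p) : LpR p :=
  ((Lp.memLp f).indicator hS).toLp (S.indicator f)

theorem coeFn_indicatorLp {S : Set ℝ} (hS : MeasurableSet S) (f : LpR p) :
    indicatorLp hS f =ᵐ[volume] S.indicator f :=
  MemLp.coeFn_toLp _

theorem indicatorLp_add {S : Set ℝ} (hS : MeasurableSet S) (f g : LpR p) :
    indicatorLp hS (f + g) = indicatorLp hS f + indicatorLp hS g := by
  refine Lp.ext ?_
  filter_upwards [coeFn_indicatorLp hS (f + g), coeFn_indicatorLp hS f, coeFn_indicatorLp hS g,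
    Lp.coeFn_add f g, Lp.coeFn_add (indicatorLp hS f) (indicatorLp hS g)] with x h1 h2 h3 h4 h5
  rw [h5, Pi.add_apply, h1, h2, h3]
  by_cases hx : x ∈ S
  · simp only [Set.indicator_of_mem hx, h4, Pi.add_apply]
  · simp only [Set.indicator_of_notMem hx, add_zero]

theorem indicatorLp_smul {S : Set ℝ} (hS : MeasurableSet S) (c : ℝ) (f : LpR p) :
    indicatorLp hS (c • f) = c • indicatorLp hS f := by
  refine Lp.ext ?_
  filter_upwards [coeFn_indicatorLp hS (c • f), coeFn_indicatorLp hS f,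
    Lp.coeFn_smul c f, Lp.coeFn_smul c (indicatorLp hS f)] with x h1 h2 h3 h4
  rw [h4, Pi.smul_apply, h1, h2]
  by_cases hx : x ∈ S
  · simp only [Set.indicator_of_mem hx, h3, Pi.smul_apply]
  · simp only [Set.indicator_of_notMem hx, smul_zero]

theorem norm_indicatorLp_le {S : Set ℝ} (hS : MeasurableSet S) (f : LpR p) :
    ‖indicatorLp hS f‖ ≤ ‖f‖ := by
  refine Lp.norm_le_norm_of_ae_le ?_
  filter_upwards [coeFn_indicatorLp hS f] with x hx
  rw [hx]
  exact norm_indicator_le_norm_self _ _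

theorem coeFn_sum_Lp {ι : Type*} (s : Finset ι) (f : ι → LpR p) :
    ⇑(∑ j ∈ s, f j) =ᵐ[volume] fun x => ∑ j ∈ s, f j x := by
  classical
  induction s using Finset.induction_on with
  | empty =>
    filter_upwards [Lp.coeFn_zero ℝ p volume] with x hx
    simpa only [Finset.sum_empty, Pi.zero_apply] using hx
  | insert a s ha ih =>
    rw [Finset.sum_insert ha]
    filter_upwards [ih, Lp.coeFn_add (f a) (∑ j ∈ s, f j)] with x h1 h2
    rw [h2, Pi.add_apply, h1, Finset.sum_insert ha]

variable [Fact (1 ≤ p)]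

variable (p) in
/-- Multiplication by the indicator function of a measurable set, as an operator on `L_p`. -/
def indicatorCLM {S : Set ℝ} (hS : MeasurableSet S) : LpR p →L[ℝ] LpR p :=
  LinearMap.mkContinuous
    { toFun := indicatorLp hS
      map_add' := indicatorLp_add hS
      map_smul' := indicatorLp_smul hS } 1 fun f =>
    (norm_indicatorLp_le hS f).trans_eq (one_mul _).symm

theorem coeFn_indicatorCLM {S : Set ℝ} (hS : MeasurableSet S) (f : LpR p) :
    indicatorCLM p hS f =ᵐ[volume] S.indicator f :=
  coeFn_indicatorLp hS f

theorem norm_indicatorCLM_apply_le {S : Set ℝ} (hS : MeasurableSet S) (f : LpR p) :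
    ‖indicatorCLM p hS f‖ ≤ ‖f‖ :=
  norm_indicatorLp_le hS f

/-- An operator whose values are all multiples of one function is compact. -/
theorem isCompactOperator_of_forall_ae_eq_mul (T : LpR p →L[ℝ] LpR p) (w : ℝ → ℝ)
    (h : ∀ f, ∃ c : ℝ, T f =ᵐ[volume] fun x => c * w x) : IsCompactOperator T := by
  by_cases h0 : ∃ f₀, T f₀ ≠ 0
  · obtain ⟨f₀, hf₀⟩ := h0
    obtain ⟨c₀, hc₀⟩ := h f₀
    have hc₀0 : c₀ ≠ 0 := by
      rintro rfl
      refine hf₀ (Lp.ext ?_)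
      filter_upwards [hc₀, Lp.coeFn_zero ℝ p volume] with x hx hx0
      rw [hx, hx0]
      simp
    have hmem : ∀ f, T f ∈ Submodule.span ℝ {T f₀} := by
      intro f
      obtain ⟨c, hc⟩ := h f
      refine Submodule.mem_span_singleton.2 ⟨c / c₀, Lp.ext ?_⟩
      filter_upwards [hc, hc₀, Lp.coeFn_smul (c / c₀) (T f₀)] with x h1 h2 h3
      rw [h3, Pi.smul_apply, h1, h2, smul_eq_mul]
      field_simp
    exact (isCompactOperator_of_locallyCompactSpace_dom
      (T.codRestrict (Submodule.span ℝ {T f₀}) hmem)).clm_comp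
      (Submodule.span ℝ {T f₀}).subtypeL
  · push Not at h0
    have : T = 0 := by ext1 f; simpa using h0 f
    rw [this]
    exact isCompactOperator_zero

variable {u v : ℝ → ℝ} {G : LpR p →L[ℝ] LpR p}

theorem IsGreenOp.coeFn_indicatorCLM_comp (hG : IsGreenOp u v p G) {S S' : Set ℝ}
    (hS : MeasurableSet S) (hS' : MeasurableSet S') (f : LpR p) :
    (indicatorCLM p hS ∘L G ∘L indicatorCLM p hS') f =ᵐ[volume]
      S.indicator fun x => ∫ t, greenKernel u v x t * S'.indicator f t := by
  filter_upwards [coeFn_indicatorCLM hS (G (indicatorCLM p hS' f)),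
    hG (indicatorCLM p hS' f)] with x h1 h2
  rw [ContinuousLinearMap.comp_apply, ContinuousLinearMap.comp_apply, h1]
  by_cases hx : x ∈ S
  · rw [Set.indicator_of_mem hx, Set.indicator_of_mem hx, h2]
    refine integral_congr_ae ?_
    filter_upwards [coeFn_indicatorCLM hS' f] with t ht
    rw [ht]
  · rw [Set.indicator_of_notMem hx, Set.indicator_of_notMem hx]

theorem IsGreenOp.isCompactOperator_of_lt (hG : IsGreenOp u v p G) {S S' : Set ℝ}
    (hS : MeasurableSet S) (hS' : MeasurableSet S') (h : ∀ x ∈ S, ∀ t ∈ S', t < x) :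
    IsCompactOperator (indicatorCLM p hS ∘L G ∘L indicatorCLM p hS') := by
  refine isCompactOperator_of_forall_ae_eq_mul _ (S.indicator u) fun f =>
    ⟨∫ t, v t * S'.indicator f t, ?_⟩
  filter_upwards [hG.coeFn_indicatorCLM_comp hS hS' f] with x hx
  rw [hx]
  by_cases hxS : x ∈ S
  · rw [Set.indicator_of_mem hxS, Set.indicator_of_mem hxS, mul_comm, ← integral_const_mul]
    congr 1 with t
    by_cases ht : t ∈ S'
    · rw [greenKernel, if_pos (h x hxS t ht).le, mul_assoc]
    · rw [Set.indicator_of_notMem ht]; ring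
  · rw [Set.indicator_of_notMem hxS, Set.indicator_of_notMem hxS, mul_zero]

theorem IsGreenOp.isCompactOperator_of_gt (hG : IsGreenOp u v p G) {S S' : Set ℝ}
    (hS : MeasurableSet S) (hS' : MeasurableSet S') (h : ∀ x ∈ S, ∀ t ∈ S', x < t) :
    IsCompactOperator (indicatorCLM p hS ∘L G ∘L indicatorCLM p hS') := by
  refine isCompactOperator_of_forall_ae_eq_mul _ (S.indicator v) fun f =>
    ⟨∫ t, u t * S'.indicator f t, ?_⟩
  filter_upwards [hG.coeFn_indicatorCLM_comp hS hS' f] with x hx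
  rw [hx]
  by_cases hxS : x ∈ S
  · rw [Set.indicator_of_mem hxS, Set.indicator_of_mem hxS, mul_comm, ← integral_const_mul]
    congr 1 with t
    by_cases ht : t ∈ S'
    · rw [greenKernel, if_neg (h x hxS t ht).not_ge]; ring
    · rw [Set.indicator_of_notMem ht]; ring
  · rw [Set.indicator_of_notMem hxS, Set.indicator_of_notMem hxS, mul_zero]

theorem sum_indicatorCLM_preimage {c : ℝ → ℤ} (hc : Measurable c) {s : Finset ℤ}
    (hs : ∀ x, c x ∈ s) (f : LpR p) :
    ∑ j ∈ s, indicatorCLM p (hc (measurableSet_singleton j)) f = f := by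
  refine Lp.ext ?_
  filter_upwards [coeFn_sum_Lp s fun j => indicatorCLM p (hc (measurableSet_singleton j)) f,
    (eventually_countable_forall.2 fun j : ℤ =>
      coeFn_indicatorCLM (hc (measurableSet_singleton j)) f)] with x h1 h2
  rw [h1, Finset.sum_eq_single (c x)]
  · rw [h2]; simp
  · intro j _ hj
    rw [h2]
    simp [hj.symm]
  · exact fun h => absurd (hs x) h

/-- The block-diagonal part of an operator with respect to the level sets of `c`. -/
def blockDiagonal (G : LpR p →L[ℝ] LpR p) {c : ℝ → ℤ} (hc : Measurable c) (s : Finset ℤ) :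
    LpR p →L[ℝ] LpR p :=
  ∑ j ∈ s, indicatorCLM p (hc (measurableSet_singleton j)) ∘L G ∘L
    indicatorCLM p (hc (measurableSet_singleton j))

theorem IsGreenOp.isCompactOperator_sub_blockDiagonal (hG : IsGreenOp u v p G) {c : ℝ → ℤ}
    (hcm : Monotone c) (hc : Measurable c) {s : Finset ℤ} (hs : ∀ x, c x ∈ s) :
    IsCompactOperator (G - blockDiagonal G hc s) := by
  classical
  have e : G - blockDiagonal G hc s = ∑ i ∈ s, ∑ j ∈ s.erase i,
      indicatorCLM p (hc (measurableSet_singleton i)) ∘L G ∘L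
        indicatorCLM p (hc (measurableSet_singleton j)) := by
    rw [sub_eq_iff_eq_add, blockDiagonal, ← Finset.sum_add_distrib]
    rw [Finset.sum_congr rfl fun i hi => Finset.sum_erase_add s (fun j =>
      indicatorCLM p (hc (measurableSet_singleton i)) ∘L G ∘L
        indicatorCLM p (hc (measurableSet_singleton j))) hi]
    ext1 f
    simp only [sum_apply, ContinuousLinearMap.comp_apply]
    simp_rw [← map_sum]
    rw [sum_indicatorCLM_preimage hc hs, sum_indicatorCLM_preimage hc hs]
  rw [e]
  refine (compactOperator (RingHom.id ℝ) (LpR p) (LpR p)).sum_mem fun i _ =>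
    Submodule.sum_mem _ fun j hj => ?_
  rcases lt_or_gt_of_ne (Finset.ne_of_mem_erase hj) with hij | hij
  · refine hG.isCompactOperator_of_lt _ _ fun x hx t ht => hcm.reflect_lt ?_
    rw [Set.mem_preimage, Set.mem_singleton_iff] at hx ht
    omega
  · refine hG.isCompactOperator_of_gt _ _ fun x hx t ht => hcm.reflect_lt ?_
    rw [Set.mem_preimage, Set.mem_singleton_iff] at hx ht
    omega

theorem IsGreenOp.coeFn_blockDiagonal (hG : IsGreenOp u v p G) {c : ℝ → ℤ}
    (hc : Measurable c) {s : Finset ℤ} (hs : ∀ x, c x ∈ s) (f : LpR p) :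
    blockDiagonal G hc s f =ᵐ[volume]
      fun x => ∫ t, greenKernel u v x t * (c ⁻¹' {c x}).indicator f t := by
  rw [blockDiagonal, sum_apply]
  filter_upwards [coeFn_sum_Lp s fun j => (indicatorCLM p (hc (measurableSet_singleton j)) ∘L
      G ∘L indicatorCLM p (hc (measurableSet_singleton j))) f,
    (eventually_countable_forall.2 fun j : ℤ => hG.coeFn_indicatorCLM_comp
      (hc (measurableSet_singleton j)) (hc (measurableSet_singleton j)) f)] with x h1 h2
  rw [h1, Finset.sum_eq_single (c x)]
  · rw [h2]; simp
  · intro j _ hj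
    rw [h2]
    simp [hj.symm]
  · exact fun h => absurd (hs x) h

theorem IsGreenOp.norm_blockDiagonal_le (hG : IsGreenOp u v p G) (h : MonotonePair u v)
    (hp1 : 1 < p) (hp2 : p ≠ ⊤) {c : ℝ → ℤ} (hc : Measurable c) {s : Finset ℤ}
    (hs : ∀ x, c x ∈ s) {η : ℝ} (hη : 0 ≤ η)
    (h1 : ∀ x, ∫⁻ t in c ⁻¹' {c x}, ENNReal.ofReal
      (greenKernel u v x t * (u t * v t) ^ p.toReal⁻¹) ≤
        ENNReal.ofReal (η * (u x * v x) ^ p.toReal⁻¹))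
    (h2 : ∀ x, ∫⁻ t in c ⁻¹' {c x}, ENNReal.ofReal
      (greenKernel u v x t * (u t * v t) ^ (1 - p.toReal⁻¹)) ≤
        ENNReal.ofReal (η * (u x * v x) ^ (1 - p.toReal⁻¹))) :
    ‖blockDiagonal G hc s‖ ≤ η := by
  have hp0 : p ≠ 0 := (zero_lt_one.trans hp1).ne'
  have hP1 : 1 < p.toReal := by
    rw [← ENNReal.toReal_one]
    exact (ENNReal.toReal_lt_toReal ENNReal.one_ne_top hp2).2 hp1
  have hPQ := Real.HolderConjugate.conjExponent hP1
  set P := p.toReal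
  set Q := P.conjExponent
  have hP := hPQ.pos
  have hQ := hPQ.symm.pos
  have hQinv : Q⁻¹ = 1 - P⁻¹ := by linarith [hPQ.inv_add_inv_eq_one]
  set K : ℝ → ℝ → ℝ≥0∞ := fun x t =>
    (c ⁻¹' {c x}).indicator (fun t => ENNReal.ofReal (greenKernel u v x t)) t with hKdef
  set w : ℝ → ℝ≥0∞ := fun x => ENNReal.ofReal ((u x * v x) ^ (P * Q)⁻¹)
  have hw : Measurable w :=
    (((h.continuous_u.mul h.continuous_v).measurable).pow_const _).ennreal_ofReal
  have hK : Measurable (Function.uncurry K) := by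
    have : Function.uncurry K = {z : ℝ × ℝ | c z.2 = c z.1}.indicator
        fun z => ENNReal.ofReal (greenKernel u v z.1 z.2) := by
      ext ⟨x, t⟩
      by_cases hx : c t = c x <;> simp [hKdef, Set.indicator, hx]
    rw [this]
    exact h.measurable_greenKernel.ennreal_ofReal.indicator
      (measurableSet_eq_fun (hc.comp measurable_snd) (hc.comp measurable_fst))
  have hKcomm : ∀ x t, K x t = K t x := by
    intro x t
    by_cases hx : c t = c x
    · simp [hKdef, Set.indicator, hx, greenKernel_comm u v x t]
    · simp [hKdef, Set.indicator, hx, Ne.symm hx]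
  have hwpow : ∀ {e a : ℝ}, 0 < e → (P * Q)⁻¹ * e = a → ∀ x,
      w x ^ e = ENNReal.ofReal ((u x * v x) ^ a) := by
    intro e a he hea x
    have := (h.mul_pos x).le
    rw [ENNReal.ofReal_rpow_of_nonneg (by positivity) he.le, ← Real.rpow_mul this, hea]
  have hwQ : ∀ x, w x ^ Q = ENNReal.ofReal ((u x * v x) ^ P⁻¹) :=
    hwpow hQ (by field_simp)
  have hwP : ∀ x, w x ^ P = ENNReal.ofReal ((u x * v x) ^ (1 - P⁻¹)) :=
    hwpow hP (by rw [← hQinv]; field_simp)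
  have hSchur : ∀ {e a : ℝ}, (∀ x, w x ^ e = ENNReal.ofReal ((u x * v x) ^ a)) →
      (∀ x, ∫⁻ t in c ⁻¹' {c x}, ENNReal.ofReal (greenKernel u v x t * (u t * v t) ^ a) ≤
        ENNReal.ofReal (η * (u x * v x) ^ a)) →
      ∀ x, ∫⁻ t, K x t * w t ^ e ≤ ENNReal.ofReal η * w x ^ e := by
    intro e a hwe hint x
    rw [hwe, ← ENNReal.ofReal_mul hη]
    refine le_trans (le_of_eq ?_) (hint x)
    rw [← lintegral_indicator (hc (measurableSet_singleton _))]
    congr 1 with t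
    by_cases ht : t ∈ c ⁻¹' {c x}
    · simp only [hKdef, Set.indicator_of_mem ht, hwe,
        ENNReal.ofReal_mul (h.greenKernel_pos x t).le]
    · simp only [hKdef, Set.indicator_of_notMem ht, zero_mul]
  refine ContinuousLinearMap.opNorm_le_bound _ hη fun f => ?_
  have hf : Measurable f := (Lp.stronglyMeasurable f).measurable
  have key := lintegral_rpow_lintegral_mul_le hPQ hK hw
    (fun x => (ENNReal.ofReal_pos.2 (Real.rpow_pos_of_pos (h.mul_pos x) _)).ne')
    (fun x => ENNReal.ofReal_ne_top) (ENNReal.ofReal_ne_top (r := η)) (hSchur hwQ h1)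
    (fun t => by simpa only [hKcomm t] using hSchur hwP h2 t) hf.enorm
  have hle : eLpNorm (blockDiagonal G hc s f) p volume ≤
      ENNReal.ofReal η * eLpNorm f p volume := by
    rw [eLpNorm_eq_lintegral_rpow_enorm_toReal hp0 hp2,
      eLpNorm_eq_lintegral_rpow_enorm_toReal hp0 hp2]
    calc (∫⁻ x, ‖blockDiagonal G hc s f x‖ₑ ^ P) ^ (1 / P)
        ≤ (ENNReal.ofReal η ^ P * ∫⁻ x, ‖f x‖ₑ ^ P) ^ (1 / P) := by
          refine ENNReal.rpow_le_rpow (le_trans (lintegral_mono_ae ?_) key) (by positivity)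
          filter_upwards [hG.coeFn_blockDiagonal hc hs f] with x hx
          rw [hx]
          refine ENNReal.rpow_le_rpow ((enorm_integral_le_lintegral_enorm _).trans_eq ?_) hP.le
          congr 1 with t
          by_cases ht : t ∈ c ⁻¹' {c x}
          · simp only [hKdef, Set.indicator_of_mem ht, enorm_mul,
              Real.enorm_of_nonneg (h.greenKernel_pos x t).le]
          · simp only [hKdef, Set.indicator_of_notMem ht, zero_mul, mul_zero, enorm_zero]
      _ = _ := by
          rw [ENNReal.mul_rpow_of_nonneg _ _ (by positivity), ← ENNReal.rpow_mul,
            mul_one_div_cancel hP.ne', ENNReal.rpow_one]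
  rw [Lp.norm_def, Lp.norm_def, ← ENNReal.toReal_ofReal hη, ← ENNReal.toReal_mul]
  exact ENNReal.toReal_mono (ENNReal.mul_ne_top ENNReal.ofReal_ne_top (Lp.eLpNorm_ne_top f)) hle

/-- The line can be cut into finitely many intervals, each of which is either far from the origin
or short. -/
theorem exists_monotone_cells (N : ℕ) {k : ℕ} (hk : 0 < k) :
    ∃ (c : ℝ → ℤ) (s : Finset ℤ), Monotone c ∧ (∀ x, c x ∈ s) ∧ ∀ x,
      (∀ m, c m = c x → (N : ℝ) ≤ |m|) ∨
        ((∀ m, c m = c x → |m| ≤ N + 1) ∧ volume (c ⁻¹' {c x}) ≤ ENNReal.ofReal (1 / k)) := by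
  have hk' : (0 : ℝ) < k := by exact_mod_cast hk
  have hk1 : (1 : ℝ) ≤ k := by exact_mod_cast hk
  set M : ℤ := k * (N + 1)
  have hM : (M : ℝ) = k * (N + 1) := by push_cast [M]; ring
  have hM0 : 0 < M := by positivity
  refine ⟨fun x => max (-M) (min M ⌊k * x⌋), Finset.Icc (-M) M, ?_, ?_, ?_⟩
  · intro x y hxy
    have := Int.floor_mono (mul_le_mul_of_nonneg_left hxy hk'.le)
    dsimp only
    omega
  · intro x
    rw [Finset.mem_Icc]
    dsimp only
    omega
  · intro x
    have hfloor : ∀ m : ℝ, (⌊k * m⌋ : ℝ) ≤ k * m ∧ k * m < ⌊k * m⌋ + 1 := fun m =>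
      ⟨Int.floor_le _, Int.lt_floor_add_one _⟩
    by_cases hx : M ≤ ⌊k * x⌋ ∨ ⌊k * x⌋ ≤ -M
    · left
      intro m hm
      dsimp only at hm
      rcases (by omega : M ≤ ⌊k * m⌋ ∨ ⌊k * m⌋ ≤ -M) with hm' | hm'
      · have h1 : (M : ℝ) ≤ ⌊k * m⌋ := by exact_mod_cast hm'
        refine le_abs.2 (Or.inl ?_)
        have : k * (N : ℝ) ≤ k * m := by nlinarith [(hfloor m).1]
        exact le_of_mul_le_mul_left this hk'
      · have h1 : (⌊k * m⌋ : ℝ) ≤ -M := by exact_mod_cast hm'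
        refine le_abs.2 (Or.inr ?_)
        have : k * (N : ℝ) ≤ k * -m := by nlinarith [(hfloor m).2]
        exact le_of_mul_le_mul_left this hk'
    · right
      push Not at hx
      have heq : ∀ m : ℝ, max (-M) (min M ⌊k * m⌋) = max (-M) (min M ⌊k * x⌋) →
          ⌊k * m⌋ = ⌊k * x⌋ := by
        intro m hm
        omega
      refine ⟨fun m hm => ?_, ?_⟩
      · have hm' := heq m hm
        have h1 : (⌊k * m⌋ : ℝ) + 1 ≤ M := by exact_mod_cast (by omega : ⌊k * m⌋ + 1 ≤ M)
        have h2 : (-M : ℝ) ≤ ⌊k * m⌋ := by exact_mod_cast (by omega : -M ≤ ⌊k * m⌋)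
        rw [abs_le]
        constructor
        · have : k * (-(N + 1 : ℝ)) ≤ k * m := by nlinarith [(hfloor m).1]
          exact le_of_mul_le_mul_left this hk'
        · have : k * m ≤ k * (N + 1 : ℝ) := by nlinarith [(hfloor m).2]
          exact le_of_mul_le_mul_left this hk'
      · have hsub : (fun x : ℝ => max (-M) (min M ⌊k * x⌋)) ⁻¹' {max (-M) (min M ⌊k * x⌋)} ⊆
            Set.Icc ((⌊k * x⌋ : ℝ) / k) ((⌊k * x⌋ + 1) / k) := by
          intro m hm
          have hm' := heq m hm
          rw [Set.mem_Icc, div_le_iff₀ hk', le_div_iff₀ hk', ← hm', mul_comm m]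
          exact ⟨(hfloor m).1, (hfloor m).2.le⟩
        refine (measure_mono hsub).trans_eq ?_
        rw [Real.volume_Icc]
        congr 1
        ring

/-- If `ρ = u v` satisfies `ρ d → 0` at infinity, where the intervals of radius `d` have
`logRatio`-length bounded below, then the Green operator is compact. -/
theorem IsGreenOp.isCompactOperator_of_tendsto (hG : IsGreenOp u v p G) (h : MonotonePair u v)
    (hp1 : 1 < p) (hp2 : p ≠ ⊤) {d : ℝ → ℝ}
    (hθ : ∀ x, 1 / 2 ≤ logRatio u v (x + d x) - logRatio u v (x - d x))
    (ht : Tendsto (fun x => u x * v x * d x) (cocompact ℝ) (𝓝 0)) : IsCompactOperator G := by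
  have hP1 : 1 < p.toReal := by
    rw [← ENNReal.toReal_one]
    exact (ENNReal.toReal_lt_toReal ENNReal.one_ne_top hp2).2 hp1
  have ha0 : 0 < p.toReal⁻¹ := by positivity
  have ha1 : p.toReal⁻¹ < 1 := inv_lt_one_of_one_lt₀ hP1
  obtain ⟨C₁, hC₁, hC₁'⟩ := h.exists_setLIntegral_greenKernel_le hθ ha0 ha1
  obtain ⟨C₂, hC₂, hC₂'⟩ := h.exists_setLIntegral_greenKernel_le hθ
    (a := 1 - p.toReal⁻¹) (by linarith) (by linarith)
  suffices hcl : G ∈ closure {T : LpR p →L[ℝ] LpR p | IsCompactOperator T} by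
    rwa [isClosed_setOfPred_isCompactOperator.closure_eq] at hcl
  refine Metric.mem_closure_iff.2 fun η₂ hη₂ => ?_
  set η := η₂ / 2
  have hη : 0 < η := half_pos hη₂
  set ε := η / (C₁ + C₂)
  have hε : 0 < ε := by positivity
  have hεC : (C₁ + C₂) * ε = η := by simp only [ε]; field_simp
  obtain ⟨N, hN⟩ : ∃ N : ℕ, ∀ x : ℝ, (N : ℝ) ≤ |x| → u x * v x * d x ≤ ε := by
    have hev := ht.eventually (ge_mem_nhds hε)
    rw [cocompact_eq_atBot_atTop, eventually_sup] at hev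
    obtain ⟨a, ha⟩ := eventually_atBot.1 hev.1
    obtain ⟨b, hb⟩ := eventually_atTop.1 hev.2
    obtain ⟨N, hN⟩ := exists_nat_ge (max (-a) b)
    refine ⟨N, fun x hx => ?_⟩
    rcases le_abs.1 hx with hx | hx
    · exact hb x ((le_max_right _ _).trans (hN.trans hx))
    · exact ha x (by linarith [le_max_left (-a) b])
  obtain ⟨B, hB⟩ : ∃ B : ℝ, ∀ x ∈ Set.Icc (-(N + 1 : ℝ)) (N + 1), u x * v x ≤ B := by
    obtain ⟨B, hB⟩ := (isCompact_Icc (a := -(N + 1 : ℝ)) (b := N + 1)).bddAbove_image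
      (h.continuous_u.mul h.continuous_v).continuousOn
    exact ⟨B, fun x hx => hB ⟨x, hx, rfl⟩⟩
  have hB0 : 0 < B := (h.mul_pos 0).trans_le (hB 0 (by constructor <;> linarith))
  obtain ⟨k, hk⟩ := exists_nat_gt (B / η)
  have hk0 : (0 : ℝ) < k := (by positivity : 0 < B / η).trans hk
  have hkB : B * (1 / k) ≤ η := by
    rw [div_lt_iff₀ hη] at hk
    rw [mul_one_div, div_le_iff₀ hk0]
    linarith
  obtain ⟨c, s, hcm, hcs, hcell⟩ := exists_monotone_cells N (k := k) (by exact_mod_cast hk0)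
  have hc : Measurable c := hcm.measurable
  have hint : ∀ {a C : ℝ}, 0 ≤ a → a ≤ 1 → 0 ≤ C → C ≤ C₁ + C₂ →
      (∀ (S : Set ℝ) (ε : ℝ), S.OrdConnected → 0 ≤ ε → (∀ m ∈ S, u m * v m * d m ≤ ε) → ∀ x,
        ∫⁻ t in S, ENNReal.ofReal (greenKernel u v x t * (u t * v t) ^ a) ≤
          ENNReal.ofReal (C * ε * (u x * v x) ^ a)) →
      ∀ x, ∫⁻ t in c ⁻¹' {c x}, ENNReal.ofReal (greenKernel u v x t * (u t * v t) ^ a) ≤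
        ENNReal.ofReal (η * (u x * v x) ^ a) := by
    intro a C ha0 ha1 hC0 hC hCint x
    have hρ := (h.mul_pos x).le
    rcases hcell x with hout | ⟨hin, hvol⟩
    · refine (hCint (c ⁻¹' {c x}) ε (Set.ordConnected_singleton.preimage_mono hcm) hε.le
        (fun m hm => hN m (hout m hm)) x).trans (ENNReal.ofReal_le_ofReal ?_)
      rw [← hεC]
      gcongr
    · calc ∫⁻ t in c ⁻¹' {c x}, ENNReal.ofReal (greenKernel u v x t * (u t * v t) ^ a)
          ≤ ∫⁻ _ in c ⁻¹' {c x}, ENNReal.ofReal ((u x * v x) ^ a * B) := by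
            refine setLIntegral_mono measurable_const fun t ht => ENNReal.ofReal_le_ofReal ?_
            refine (h.greenKernel_mul_rpow_le (δ := 0) ha0 (by linarith) x t).trans ?_
            rw [zero_mul, neg_zero, Real.exp_zero, mul_one]
            gcongr
            exact hB t (abs_le.1 (hin t ht))
        _ = ENNReal.ofReal ((u x * v x) ^ a * B) * volume (c ⁻¹' {c x}) := setLIntegral_const _ _
        _ ≤ ENNReal.ofReal ((u x * v x) ^ a * B) * ENNReal.ofReal (1 / k) := by gcongr
        _ = ENNReal.ofReal (B * (1 / k) * (u x * v x) ^ a) := by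
            rw [← ENNReal.ofReal_mul (by positivity)]
            congr 1
            ring
        _ ≤ _ := by
            refine ENNReal.ofReal_le_ofReal ?_
            gcongr
  refine ⟨G - blockDiagonal G hc s, hG.isCompactOperator_sub_blockDiagonal hcm hc hcs, ?_⟩
  rw [dist_eq_norm, sub_sub_cancel]
  refine (hG.norm_blockDiagonal_le h hp1 hp2 hc hcs hη.le ?_ ?_).trans_lt (half_lt_self hη₂)
  · exact hint ha0.le ha1.le hC₁.le (by linarith) hC₁'
  · exact hint (by linarith) (by linarith) hC₂.le (by linarith) hC₂'

theorem exists_forall_norm_indicatorCLM_le (hp : p ≠ ⊤) (g : LpR p) {ε : ℝ} (hε : 0 < ε) :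
    ∃ N : ℝ, ∀ (S : Set ℝ) (hS : MeasurableSet S), (∀ y ∈ S, N < |y|) →
      ‖indicatorCLM p hS g‖ ≤ ε := by
  obtain ⟨g', hsupp, hle, -, hg'⟩ := (Lp.memLp g).exists_hasCompactSupport_eLpNorm_sub_le hp
    (ε := ENNReal.ofReal ε) (ENNReal.ofReal_pos.2 hε).ne'
  obtain ⟨N, hN⟩ := hsupp.isCompact.isBounded.exists_norm_le
  refine ⟨N, fun S hS hSN => ?_⟩
  have h0 : ∀ y ∈ S, g' y = 0 := fun y hy => by
    by_contra hne
    exact (hSN y hy).not_ge (hN y (subset_tsupport _ hne))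
  have hnorm : ‖g - hg'.toLp g'‖ ≤ ε := by
    rw [Lp.norm_def]
    refine ENNReal.toReal_le_of_le_ofReal hε.le (le_trans (le_of_eq (eLpNorm_congr_ae ?_)) hle)
    filter_upwards [Lp.coeFn_sub g (hg'.toLp g'), hg'.coeFn_toLp] with x h1 h2
    rw [h1, Pi.sub_apply, Pi.sub_apply, h2]
  refine le_trans (Lp.norm_le_norm_of_ae_le ?_) hnorm
  filter_upwards [coeFn_indicatorCLM hS g, Lp.coeFn_sub g (hg'.toLp g'), hg'.coeFn_toLp]
    with x h1 h2 h3
  by_cases hx : x ∈ S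
  · rw [h1, h2, Pi.sub_apply, h3, h0 x hx, sub_zero, Set.indicator_of_mem hx]
  · rw [h1, Set.indicator_of_notMem hx, norm_zero]
    exact norm_nonneg _

/-- The values of a compact operator on `L_p` have uniformly small tails. -/
theorem exists_forall_norm_indicatorCLM_comp_le (hp : p ≠ ⊤) {T : LpR p →L[ℝ] LpR p}
    (hT : IsCompactOperator T) {ε : ℝ} (hε : 0 < ε) :
    ∃ N : ℝ, ∀ (S : Set ℝ) (hS : MeasurableSet S), (∀ y ∈ S, N < |y|) →
      ‖indicatorCLM p hS ∘L T‖ ≤ ε := by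
  have hc : IsCompact (closure (T '' Metric.closedBall 0 1)) :=
    IsCompactOperator.isCompact_closure_image_closedBall (f := (T : LpR p →ₗ[ℝ] LpR p)) hT 1
  obtain ⟨t, ht, hcover⟩ := Metric.totallyBounded_iff.1 hc.totallyBounded (ε / 2) (half_pos hε)
  choose N hN using fun g : LpR p => exists_forall_norm_indicatorCLM_le hp g (half_pos hε)
  obtain ⟨M, hM⟩ := (ht.image N).bddAbove
  refine ⟨M, fun S hS hSM => ContinuousLinearMap.opNorm_le_of_unit_norm hε.le fun f hf => ?_⟩
  have hTf : T f ∈ closure (T '' Metric.closedBall 0 1) :=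
    subset_closure ⟨f, by rw [mem_closedBall_zero_iff, hf], rfl⟩
  obtain ⟨g, hg, hTg⟩ := Set.mem_iUnion₂.1 (hcover hTf)
  have h1 := hN g S hS fun y hy => (hM ⟨g, hg, rfl⟩).trans_lt (hSM y hy)
  have h2 := norm_indicatorCLM_apply_le hS (T f - g)
  rw [mem_ball_iff_norm] at hTg
  calc ‖indicatorCLM p hS (T f)‖
      = ‖indicatorCLM p hS (T f - g) + indicatorCLM p hS g‖ := by rw [← map_add, sub_add_cancel]
    _ ≤ ε := (norm_add_le _ _).trans (by linarith)

/-- Localized lower bound for the Green operator on intervals of `logRatio`-length at most `2`. -/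
theorem IsGreenOp.le_norm_indicatorCLM_comp (hG : IsGreenOp u v p G) (h : MonotonePair u v)
    (hp : p ≠ ⊤) {x δ : ℝ} (hδ : 0 < δ)
    (hθ : logRatio u v (x + δ) - logRatio u v (x - δ) ≤ 2) :
    2 * Real.exp (-4) * (u x * v x * δ) ≤
      ‖indicatorCLM p (measurableSet_Icc (a := x - δ) (b := x + δ)) ∘L G‖ := by
  have hp0 : p ≠ 0 := (zero_lt_one.trans_le (Fact.out : 1 ≤ p)).ne'
  set I := Set.Icc (x - δ) (x + δ) with hI
  have hIvol : volume I = ENNReal.ofReal (2 * δ) := by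
    rw [hI, Real.volume_Icc]; congr 1; ring
  have hIt : volume I ≠ ⊤ := by rw [hIvol]; exact ENNReal.ofReal_ne_top
  have hIm : MeasurableSet I := measurableSet_Icc
  have hdist : ∀ y ∈ I, ∀ t ∈ I, |logRatio u v y - logRatio u v t| ≤ 2 := by
    intro y hy t ht
    have hm := h.monotone_logRatio
    rw [abs_le]
    constructor <;> linarith [hm hy.1, hm hy.2, hm ht.1, hm ht.2]
  have hxI : x ∈ I := ⟨by linarith, by linarith⟩
  have hρ := h.mul_pos
  have hker : ∀ y ∈ I, ∀ t ∈ I, Real.exp (-4) * (u x * v x) ≤ greenKernel u v y t := by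
    intro y hy t ht
    have h1 : u x * v x ≤ Real.exp 2 * (u y * v y) := (h.mul_le_exp_mul x y).trans
      (mul_le_mul_of_nonneg_right (Real.exp_le_exp.2 (hdist x hxI y hy)) (hρ y).le)
    calc Real.exp (-4) * (u x * v x) ≤ Real.exp (-4) * (Real.exp 2 * (u y * v y)) := by gcongr
      _ = Real.exp (-2) * (u y * v y) := by rw [← mul_assoc, ← Real.exp_add]; norm_num
      _ ≤ Real.exp (-|logRatio u v y - logRatio u v t|) * (u y * v y) :=
        mul_le_mul_of_nonneg_right (Real.exp_le_exp.2 (neg_le_neg (hdist y hy t ht))) (hρ y).le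
      _ ≤ _ := h.exp_mul_le_greenKernel y t
  set f : LpR p := indicatorConstLp p hIm hIt (1 : ℝ) with hf
  have hfnorm : 0 < ‖f‖ := by
    rw [hf, norm_indicatorConstLp hp0 hp, norm_one, one_mul, measureReal_def, hIvol,
      ENNReal.toReal_ofReal (by positivity)]
    positivity
  set κ := 2 * Real.exp (-4) * (u x * v x * δ) with hκ
  have hκ0 : 0 ≤ κ := by have := hρ x; positivity
  refine le_of_mul_le_mul_right ?_ hfnorm
  refine le_trans ?_ (ContinuousLinearMap.le_opNorm _ f)
  rw [← abs_of_nonneg hκ0, ← Real.norm_eq_abs, ← norm_smul]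
  refine Lp.norm_le_norm_of_ae_le ?_
  have hfI : f =ᵐ[volume] I.indicator fun _ => (1 : ℝ) := indicatorConstLp_coeFn
  filter_upwards [Lp.coeFn_smul κ f, coeFn_indicatorCLM hIm (G f), hG f, hfI] with y h1 h2 h3 h4
  rw [h1, ContinuousLinearMap.comp_apply, h2, Pi.smul_apply, h4]
  by_cases hy : y ∈ I
  · rw [Set.indicator_of_mem hy, Set.indicator_of_mem hy, h3, smul_eq_mul, mul_one,
      Real.norm_of_nonneg hκ0]
    refine le_trans ?_ (le_abs_self _)
    have hint : ∫ t, greenKernel u v y t * f t = ∫ t in I, greenKernel u v y t := by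
      rw [← integral_indicator hIm]
      refine integral_congr_ae ?_
      filter_upwards [hfI] with t ht
      rw [ht]
      by_cases htI : t ∈ I <;> simp [htI]
    have hintegrable : IntegrableOn (greenKernel u v y) I := by
      refine Measure.integrableOn_of_bounded (M := u (x - δ) * v (x + δ)) hIt
        (h.measurable_greenKernel.comp measurable_prodMk_left).aestronglyMeasurable ?_
      filter_upwards [ae_restrict_mem hIm] with t ht
      rw [Real.norm_of_nonneg (h.greenKernel_pos y t).le, greenKernel]
      split_ifs
      · exact mul_le_mul (h.antitone_u hy.1) (h.monotone_v ht.2) (h.v_pos _).le (h.u_pos _).le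
      · exact mul_le_mul (h.antitone_u ht.1) (h.monotone_v hy.2) (h.v_pos _).le (h.u_pos _).le
    rw [hint]
    calc κ = ∫ _ in I, Real.exp (-4) * (u x * v x) := by
          rw [setIntegral_const, measureReal_def, hIvol, ENNReal.toReal_ofReal (by positivity),
            smul_eq_mul, hκ]
          ring
      _ ≤ ∫ t in I, greenKernel u v y t :=
          setIntegral_mono_on (integrableOn_const hIt) hintegrable hIm (hker y hy)
  · rw [Set.indicator_of_notMem hy, Set.indicator_of_notMem hy, smul_zero]

theorem IsGreenOp.tendsto_of_isCompactOperator (hG : IsGreenOp u v p G) (h : MonotonePair u v)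
    (hp : p ≠ ⊤) {d : ℝ → ℝ} (hd : ∀ x, 0 < d x)
    (hθ : ∀ x, logRatio u v (x + d x) - logRatio u v (x - d x) ≤ 2)
    (htop : Tendsto (logRatio u v) atTop atTop) (hbot : Tendsto (logRatio u v) atBot atBot)
    (hc : IsCompactOperator G) : Tendsto (fun x => u x * v x * d x) (cocompact ℝ) (𝓝 0) := by
  refine Metric.tendsto_nhds.2 fun ε hε => ?_
  obtain ⟨N, hN⟩ := exists_forall_norm_indicatorCLM_comp_le hp hc
    (ε := Real.exp (-4) * ε) (by positivity)
  have hm := h.monotone_logRatio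
  have hfar : ∀ᶠ x in cocompact ℝ, ∀ y ∈ Set.Icc (x - d x) (x + d x), N < |y| := by
    rw [cocompact_eq_atBot_atTop, eventually_sup]
    constructor
    · filter_upwards [hbot.eventually_lt_atBot (logRatio u v (-N) - 2)] with x hx y hy
      refine lt_abs.2 (Or.inr ?_)
      have : y < -N := hm.reflect_lt
        (by linarith [hm hy.2, hθ x, hm (by linarith [hd x] : x - d x ≤ x)])
      linarith
    · filter_upwards [htop.eventually_gt_atTop (logRatio u v N + 2)] with x hx y hy
      refine lt_abs.2 (Or.inl ?_)
      exact hm.reflect_lt (by linarith [hm hy.1, hθ x, hm (by linarith [hd x] : x ≤ x + d x)])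
  filter_upwards [hfar] with x hx
  have h1 := (hG.le_norm_indicatorCLM_comp h hp (hd x) (hθ x)).trans (hN _ measurableSet_Icc hx)
  have h2 : 0 ≤ u x * v x * d x := (mul_pos (h.mul_pos x) (hd x)).le
  rw [Real.dist_0_eq_abs, abs_of_nonneg h2]
  have h3 : Real.exp (-4) * (2 * (u x * v x * d x)) ≤ Real.exp (-4) * ε := by linarith
  linarith [le_of_mul_le_mul_left h3 (Real.exp_pos _)]

end Operators

theorem tendsto_mul_zero_iff {ι : Type*} {l : Filter ι} {a b d : ι → ℝ}
    (ha : ∀ x, 0 ≤ a x) (hd : ∀ x, 0 ≤ d x) (hab : ∀ x, a x / 2 ≤ b x ∧ b x ≤ 2 * a x) :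
    Tendsto (fun x => a x * d x) l (𝓝 0) ↔ Tendsto (fun x => b x * d x) l (𝓝 0) := by
  constructor <;> intro ht
  · refine squeeze_zero (fun x => mul_nonneg (by linarith [ha x, (hab x).1]) (hd x))
      (fun x => ?_) (by simpa using ht.const_mul 2)
    rw [← mul_assoc]
    exact mul_le_mul_of_nonneg_right (hab x).2 (hd x)
  · refine squeeze_zero (fun x => mul_nonneg (ha x) (hd x))
      (fun x => ?_) (by simpa using ht.const_mul 2)
    rw [← mul_assoc]
    exact mul_le_mul_of_nonneg_right (by linarith [(hab x).1]) (hd x)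

/-- **Theorem 3.1.** Let `p ∈ (1,∞)`, assume (1.2), (1.3), let `u, v` be a
principal FSS, and assume the Green operator `G` is bounded on `L_p(ℝ)`.
Then `G` is compact iff `h(x) d(x) → 0` as `|x| → ∞`. -/
theorem compact_green_iff_hd_tendsto_zero
    (r q u v u' v' d₁ d₂ d : ℝ → ℝ) (p : ℝ≥0∞) (hp1 : 1 < p) (hp2 : p ≠ ⊤)
    [Fact (1 ≤ p)]
    (h12 : Cond12 r q) (h13 : Cond13 r q) (hfss : PFSS r q u v u' v')
    (hd₁ : IsD1 r q d₁) (hd₂ : IsD2 r q d₂) (hd : IsD r (hF r d₁ d₂) d)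
    (G : LpR p →L[ℝ] LpR p) (hG : IsGreenOp u v p G) :
    IsCompactOperator G ↔
      Tendsto (fun x => hF r d₁ d₂ x * d x) (cocompact ℝ) (𝓝 0) := by
  have hmul := hfss.mul_mem_Icc_hF h12 hd₁ hd₂
  have hpair := hfss.monotonePair
  have hθ := hfss.logRatio_sub_mem_Icc h12 hd₁ hd₂ hd
  rw [tendsto_mul_zero_iff (fun x => (hmul x).1.le) (fun x => (hd x).1.le)
    fun x => (hmul x).2]
  exact ⟨IsGreenOp.tendsto_of_isCompactOperator hG hpair hp2 (fun x => (hd x).1)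
      (fun x => (hθ x).2) hfss.tendsto_logRatio_atTop hfss.tendsto_logRatio_atBot,
    IsGreenOp.isCompactOperator_of_tendsto hG hpair hp1 hp2 fun x => (hθ x).1⟩
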